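/- arXiv:cs/0202022 — 13 statements merged into one kernel-verified Lean document; each statement's English description precedes it below -/
import Mathlib

section
/- A binary relation |~ on the formulas of a propositional language L is a preferential consequence relation if and only if it is the consequence relation defined by some preferential model. Moreover, if L is logically finite (built over finitely many propositional variables), then every preferential consequence relation on L is the consequence relation defined by some finite preferential model. -/
/-- Propositional formulas over a set `V` of propositional variables. -/
inductive Fm (V : Type) : Type
  | var : V → Fm V
  | fls : Fm V
  | tru : Fm V
  | neg : Fm V → Fm V
  | conj : Fm V → Fm V → Fm V
  | disj : Fm V → Fm V → Fm V
  | impl : Fm V → Fm V → Fm V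
  | iff : Fm V → Fm V → Fm V

variable {V : Type}

/-- Truth value of a formula in a world (truth assignment). -/
def Fm.eval (w : V → Bool) : Fm V → Bool
  | .var v => w v
  | .fls => false
  | .tru => true
  | .neg a => !(a.eval w)
  | .conj a b => a.eval w && b.eval w
  | .disj a b => a.eval w || b.eval w
  | .impl a b => !(a.eval w) || b.eval w
  | .iff a b => a.eval w == b.eval w

/-- A formula is valid iff it is satisfied by every world. -/
def Valid (a : Fm V) : Prop := ∀ w : V → Bool, a.eval w = true

/-- A conditional "relation": a set of conditional assertions (pairs of formulas). -/
abbrev CRel (V : Type) := Set (Fm V × Fm V)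

/-- Preferential consequence relation: Reflexivity, Left Logical Equivalence,
Right Weakening, And, Or, Cautious Monotonicity. -/
def IsPreferential (K : CRel V) : Prop :=
  (∀ a, (a, a) ∈ K) ∧
  (∀ a b c, Valid (a.iff b) → (a, c) ∈ K → (b, c) ∈ K) ∧
  (∀ a b c, Valid (a.impl b) → (c, a) ∈ K → (c, b) ∈ K) ∧
  (∀ a b c, (a, b) ∈ K → (a, c) ∈ K → (a, b.conj c) ∈ K) ∧
  (∀ a b c, (a, c) ∈ K → (b, c) ∈ K → (a.disj b, c) ∈ K) ∧
  (∀ a b c, (a, b) ∈ K → (a, c) ∈ K → (a.conj b, c) ∈ K)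

/-- Rational Monotonicity: if α∧β |~/ γ and α |~/ ¬β then α |~/ γ. -/
def RationalMonotonicity (K : CRel V) : Prop :=
  ∀ a b c, (a.conj b, c) ∉ K → (a, b.neg) ∉ K → (a, c) ∉ K

/-- A rational consequence relation is a preferential one satisfying Rational
Monotonicity. -/
def IsRational (K : CRel V) : Prop := IsPreferential K ∧ RationalMonotonicity K

/-- Disjunctive Rationality: if α |~/ γ and β |~/ γ then α∨β |~/ γ. -/
def DisjunctiveRationality (K : CRel V) : Prop :=
  ∀ a b c, (a, c) ∉ K → (b, c) ∉ K → (a.disj b, c) ∉ K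

/-- Negation Rationality: if α∧γ |~/ β and α∧¬γ |~/ β then α |~/ β. -/
def NegationRationality (K : CRel V) : Prop :=
  ∀ a b c, (a.conj c, b) ∉ K → (a.conj c.neg, b) ∉ K → (a, b) ∉ K

/-- `s` is minimal in `A` with respect to the strict order `lt`. -/
def MinIn {S : Type} (lt : S → S → Prop) (A : Set S) (s : S) : Prop :=
  s ∈ A ∧ ∀ t ∈ A, ¬ lt t s

/-- A preferential model: states, labeling by worlds, a strict partial order
satisfying the smoothness condition for each formula. -/
structure PrefModel (V : Type) where
  S : Type
  l : S → V → Bool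
  lt : S → S → Prop
  irrefl : ∀ s, ¬ lt s s
  trans : ∀ s t u, lt s t → lt t u → lt s u
  smooth : ∀ (a : Fm V) (s : S), a.eval (l s) = true →
    MinIn lt {t | a.eval (l t) = true} s ∨
    ∃ t, MinIn lt {t | a.eval (l t) = true} t ∧ lt t s

/-- The model `W` satisfies α |~ β iff every state minimal in α̂ satisfies β. -/
def PrefModel.Sat (W : PrefModel V) (a b : Fm V) : Prop :=
  ∀ s, MinIn W.lt {t | a.eval (W.l t) = true} s → b.eval (W.l s) = true

/-- The consequence relation defined by a preferential model. -/
def PrefModel.Rel (W : PrefModel V) : CRel V := {p | W.Sat p.1 p.2}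

/-- `W` is a model of the knowledge base `K`. -/
def PrefModel.Models (W : PrefModel V) (K : CRel V) : Prop := ∀ p ∈ K, W.Sat p.1 p.2

/-- Preferential entailment: `A` is satisfied by every preferential model of `K`. -/
def Entails (K : CRel V) (A : Fm V × Fm V) : Prop :=
  ∀ W : PrefModel V, W.Models K → W.Sat A.1 A.2

/-- The preferential closure of a knowledge base. -/
def PrefClosure (K : CRel V) : CRel V := {A | Entails K A}

/-- A model is well-founded iff it has no infinite descending chain of states. -/
def PrefModel.NoInfDesc (W : PrefModel V) : Prop :=
  ¬ ∃ f : ℕ → W.S, ∀ n, W.lt (f (n + 1)) (f n)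

/-- A ranked model: the strict order is given by a ranking function into a
totally ordered set. -/
def PrefModel.Ranked (W : PrefModel V) : Prop :=
  ∃ (Ω : Type) (_ : LinearOrder Ω) (r : W.S → Ω), ∀ s t, W.lt s t ↔ r s < r t

/-- α is exceptional for K iff K preferentially entails true |~ ¬α. -/
def Exceptional (K : CRel V) (a : Fm V) : Prop := Entails K (Fm.tru, a.neg)

/-- The set of assertions of K whose antecedent is exceptional for K. -/
def ESet (K : CRel V) : CRel V := {p ∈ K | Exceptional K p.1}

/-- The exceptionality hierarchy: C₀ = K, C_{τ+1} = E(C_τ), intersections at limits. -/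
noncomputable def Cseq (K : CRel V) : Ordinal.{0} → CRel V := fun τ =>
  Ordinal.limitRecOn τ K (fun _ C => ESet C)
    (fun o _ ih => ⋂ ρ : Set.Iio o, ih ρ.1 ρ.2)

/-- α has a rank for K iff it is not exceptional for some C_τ. -/
def HasRank (K : CRel V) (a : Fm V) : Prop := ∃ τ : Ordinal.{0}, ¬ Exceptional (Cseq K τ) a

/-- The rank of α for K: the least τ such that α is not exceptional for C_τ. -/
noncomputable def rnk (K : CRel V) (a : Fm V) : Ordinal.{0} :=
  sInf {τ : Ordinal.{0} | ¬ Exceptional (Cseq K τ) a}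

/-- K is admissible iff every formula with no rank is inconsistent for K. -/
def Admissible (K : CRel V) : Prop :=
  ∀ a : Fm V, ¬ HasRank K a → Entails K (a, Fm.fls)

/-- `α < β in K`: the assertion α∨β |~ ¬β belongs to K. -/
def ltIn (K : CRel V) (a b : Fm V) : Prop := (a.disj b, b.neg) ∈ K

/-- K₀ is preferable to K₁. -/
def Pref (K0 K1 : CRel V) : Prop :=
  (∃ a b, (a, b) ∈ K1 \ K0 ∧
    ∀ c, ltIn K0 c a → ∀ d, (c, d) ∈ K0 → (c, d) ∈ K1) ∧
  (∀ c d, (c, d) ∈ K0 \ K1 → ∃ r e, (r, e) ∈ K1 \ K0 ∧ ltIn K1 r c)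

/-- C is the rational closure of K: a rational extension of K preferable to
every other rational extension of K. -/
def IsRationalClosure (K C : CRel V) : Prop :=
  IsRational C ∧ K ⊆ C ∧ ∀ C', IsRational C' → K ⊆ C' → C' ≠ C → Pref C C'

/-- An assertion α |~ β is supported by K^p iff there is γ with α ⊨ γ and
γ |~ β ∈ K^p. -/
def Supported (K : CRel V) (A : Fm V × Fm V) : Prop :=
  ∃ c : Fm V, Valid (A.1.impl c) ∧ (c, A.2) ∈ PrefClosure K

/-- Classical entailment from the material counterpart of a knowledge base. -/
def MatEntails (K : CRel V) (a : Fm V) : Prop :=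
  ∀ w : V → Bool, (∀ p ∈ K, (p.1.impl p.2).eval w = true) → a.eval w = true

theorem Fm.continuous_eval (a : Fm V) : Continuous fun w : V → Bool => a.eval w := by
  induction a with
  | var v => exact continuous_apply v
  | fls => exact continuous_const
  | tru => exact continuous_const
  | neg a ha => exact (continuous_of_discreteTopology (f := Bool.not)).comp ha
  | conj a b ha hb =>
    exact (continuous_of_discreteTopology (f := fun p : Bool × Bool => p.1 && p.2)).comp
      (ha.prodMk hb)
  | disj a b ha hb =>
    exact (continuous_of_discreteTopology (f := fun p : Bool × Bool => p.1 || p.2)).comp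
      (ha.prodMk hb)
  | impl a b ha hb =>
    exact (continuous_of_discreteTopology (f := fun p : Bool × Bool => !p.1 || p.2)).comp
      (ha.prodMk hb)
  | iff a b ha hb =>
    exact (continuous_of_discreteTopology (f := fun p : Bool × Bool => p.1 == p.2)).comp
      (ha.prodMk hb)

/-- The relation defined by a preferential model is preferential. -/
theorem PrefModel.isPreferential_rel (W : PrefModel V) : IsPreferential W.Rel := by
  refine ⟨fun a s hs => hs.1, ?_, ?_, ?_, ?_, ?_⟩
  · intro a b c hab hac s hs
    have hset : {t | a.eval (W.l t) = true} = {t | b.eval (W.l t) = true} := by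
      ext t
      have := hab (W.l t)
      grind [Fm.eval]
    exact hac s (by rw [hset]; exact hs)
  · intro a b c hab hca s hs
    have h₁ := hab (W.l s)
    have h₂ := hca s hs
    grind [Fm.eval]
  · intro a b c hab hac s hs
    have h₁ := hab s hs
    have h₂ := hac s hs
    grind [Fm.eval]
  · intro a b c hac hbc s hs
    have h : a.eval (W.l s) = true ∨ b.eval (W.l s) = true := by
      simpa [Fm.eval] using hs.1
    rcases h with h | h
    · exact hac s ⟨h, fun t ht => hs.2 t (by simp [Fm.eval, show a.eval (W.l t) = true from ht])⟩
    · exact hbc s ⟨h, fun t ht => hs.2 t (by simp [Fm.eval, show b.eval (W.l t) = true from ht])⟩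
  · intro a b c hab hac s hs
    have h : a.eval (W.l s) = true ∧ b.eval (W.l s) = true := by
      simpa [Fm.eval] using hs.1
    rcases W.smooth a s h.1 with hmin | ⟨t, ht, hts⟩
    · exact hac s hmin
    · refine absurd hts (hs.2 t ?_)
      have h₁ : a.eval (W.l t) = true := ht.1
      have h₂ : b.eval (W.l t) = true := hab t ht
      simp [Fm.eval, h₁, h₂]

/-- A world is normal for `a` if it satisfies every plausible consequence of `a`. -/
def NormalWorld (K : CRel V) (a : Fm V) (w : V → Bool) : Prop :=
  ∀ c, (a, c) ∈ K → c.eval w = true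

/-- `a` is at least as normal as `b`. -/
def AsNormal (K : CRel V) (a b : Fm V) : Prop := (a.disj b, a) ∈ K

namespace IsPreferential

variable {K : CRel V} {a b c : Fm V} {w : V → Bool}

theorem refl (hK : IsPreferential K) (a : Fm V) : (a, a) ∈ K := hK.1 a

theorem left_congr (hK : IsPreferential K) (h : (a, c) ∈ K)
    (hab : ∀ w, a.eval w = b.eval w) : (b, c) ∈ K :=
  hK.2.1 a b c (fun w => by simp [Fm.eval, hab w]) h

theorem weaken (hK : IsPreferential K) (h : (c, a) ∈ K)
    (hab : ∀ w, a.eval w = true → b.eval w = true) : (c, b) ∈ K :=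
  hK.2.2.1 a b c (fun w => by have := hab w; grind [Fm.eval]) h

theorem conj (hK : IsPreferential K) (hb : (a, b) ∈ K) (hc : (a, c) ∈ K) : (a, b.conj c) ∈ K :=
  hK.2.2.2.1 a b c hb hc

theorem disj (hK : IsPreferential K) (ha : (a, c) ∈ K) (hb : (b, c) ∈ K) : (a.disj b, c) ∈ K :=
  hK.2.2.2.2.1 a b c ha hb

theorem cautious (hK : IsPreferential K) (hb : (a, b) ∈ K) (hc : (a, c) ∈ K) :
    (a.conj b, c) ∈ K :=
  hK.2.2.2.2.2 a b c hb hc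

theorem impl_of_conj (hK : IsPreferential K) (h : (a.conj b, c) ∈ K) : (a, b.impl c) ∈ K := by
  have h₁ : (a.conj b, b.impl c) ∈ K := hK.weaken h fun w => by grind [Fm.eval]
  have h₂ : (a.conj b.neg, b.impl c) ∈ K :=
    hK.weaken (hK.refl _) fun w => by grind [Fm.eval]
  exact hK.left_congr (hK.disj h₁ h₂) fun w => by grind [Fm.eval]

theorem cut (hK : IsPreferential K) (h : (a.conj b, c) ∈ K) (hb : (a, b) ∈ K) : (a, c) ∈ K :=
  hK.weaken (hK.conj hb (hK.impl_of_conj h)) fun w => by grind [Fm.eval]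

theorem asNormal_disj (hK : IsPreferential K) (hab : AsNormal K a b) (hbc : AsNormal K b c) :
    AsNormal K a (b.disj c) := by
  have h₁ : (a.disj (b.disj c), a.disj b) ∈ K :=
    hK.disj (hK.weaken (hK.refl a) fun w => by grind [Fm.eval])
      (hK.weaken hbc fun w => by grind [Fm.eval])
  exact hK.cut (hK.left_congr hab fun w => by grind [Fm.eval]) h₁

theorem asNormal_trans (hK : IsPreferential K) (hab : AsNormal K a b) (hbc : AsNormal K b c) :
    AsNormal K a c := by
  have h := hK.asNormal_disj hab hbc
  have h₁ : (a.disj (b.disj c), a.disj c) ∈ K := hK.weaken h fun w => by grind [Fm.eval]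
  exact hK.left_congr (hK.cautious h₁ h) fun w => by grind [Fm.eval]

theorem normalWorld_congr (hK : IsPreferential K) (h : NormalWorld K a w)
    (hab : ∀ w, a.eval w = b.eval w) : NormalWorld K b w :=
  fun c hc => h c (hK.left_congr hc fun w => (hab w).symm)

theorem eval_of_normalWorld (hK : IsPreferential K) (h : NormalWorld K a w) : a.eval w = true :=
  h a (hK.refl a)

theorem normalWorld_of_asNormal (hK : IsPreferential K) (hab : AsNormal K a b)
    (hw : NormalWorld K a w) (hb : b.eval w = true) : NormalWorld K b w := by
  intro c hc
  have h₁ : (a.disj b, b.impl c) ∈ K :=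
    hK.impl_of_conj (hK.left_congr hc fun w => by grind [Fm.eval])
  have h₂ : (a, b.impl c) ∈ K :=
    hK.left_congr (hK.cautious hab h₁) fun w => by grind [Fm.eval]
  have h₃ := hw _ h₂
  grind [Fm.eval]

theorem eval_of_asNormal_of_asNormal (hK : IsPreferential K) (hab : AsNormal K a b)
    (hbc : AsNormal K b c) (hw : NormalWorld K a w) (hc : c.eval w = true) :
    b.eval w = true :=
  hK.normalWorld_of_asNormal (hK.asNormal_disj hab hbc) hw (by simp [Fm.eval, hc]) b hbc

/-- By compactness, the plausible consequences of `a` are the formulas holding in all worlds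
normal for `a`. -/
theorem exists_normalWorld (hK : IsPreferential K) (h : (a, b) ∉ K) :
    ∃ w, NormalWorld K a w ∧ b.eval w = false := by
  let F : {c // (a, c) ∈ K} → Set (V → Bool) :=
    fun c => {w | c.1.eval w = true} ∩ {w | b.eval w = false}
  have hclosed : ∀ c, IsClosed (F c) := fun c =>
    (isClosed_eq c.1.continuous_eval continuous_const).inter
      (isClosed_eq b.continuous_eval continuous_const)
  have : Nonempty {c // (a, c) ∈ K} := ⟨⟨a, hK.refl a⟩⟩
  obtain ⟨w, hw⟩ := IsCompact.nonempty_iInter_of_directed_nonempty_isCompact_isClosed F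
    (by
      intro c d
      refine ⟨⟨c.1.conj d.1, hK.conj c.2 d.2⟩, ?_, ?_⟩ <;>
      · rintro w ⟨h₁, h₂⟩
        have h₁ : (c.1.eval w && d.1.eval w) = true := h₁
        rw [Bool.and_eq_true] at h₁
        first | exact ⟨h₁.1, h₂⟩ | exact ⟨h₁.2, h₂⟩)
    (by
      intro c
      by_contra hne
      refine h (hK.weaken c.2 fun w hw => ?_)
      by_contra hb
      exact hne ⟨w, hw, Bool.eq_false_of_not_eq_true hb⟩)
    (fun c => (hclosed c).isCompact) hclosed
  rw [Set.mem_iInter] at hw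
  exact ⟨w, fun c hc => (hw ⟨c, hc⟩).1, (hw ⟨a, hK.refl a⟩).2⟩

end IsPreferential

/-- Logical equivalence of formulas. -/
def Fm.equiv (V : Type) : Setoid (Fm V) := Setoid.ker fun a w => a.eval w

theorem Fm.eval_out (a : Fm V) (w : V → Bool) :
    (Quotient.mk (Fm.equiv V) a).out.eval w = a.eval w :=
  congrFun (Quotient.mk_out (s := Fm.equiv V) a) w

/-- States of the canonical model: a formula up to logical equivalence, with a world normal
for it. -/
def CanonicalState (K : CRel V) : Type :=
  {p : (V → Bool) × Quotient (Fm.equiv V) // NormalWorld K p.2.out p.1}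

instance (K : CRel V) [Finite V] : Finite (CanonicalState K) := by
  have : Finite (Quotient (Fm.equiv V)) :=
    Finite.of_injective _ (Setoid.kerLift_injective fun (a : Fm V) w => a.eval w)
  exact Subtype.finite

namespace CanonicalState

variable {K : CRel V}

/-- The world labeling a state. -/
def world (s : CanonicalState K) : V → Bool := s.1.1

/-- A representative of the formula of a state. -/
noncomputable def fm (s : CanonicalState K) : Fm V := s.1.2.out

/-- The preference order on states. -/
def lt (s t : CanonicalState K) : Prop := AsNormal K s.fm t.fm ∧ t.fm.eval s.world = false

theorem normalWorld (s : CanonicalState K) : NormalWorld K s.fm s.world := s.2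

theorem exists_mk (hK : IsPreferential K) {a : Fm V} {w : V → Bool} (h : NormalWorld K a w) :
    ∃ s : CanonicalState K, s.world = w ∧ ∀ v, s.fm.eval v = a.eval v :=
  ⟨⟨(w, Quotient.mk _ a), hK.normalWorld_congr h fun v => (a.eval_out v).symm⟩, rfl, a.eval_out⟩

theorem minIn_of_asNormal (hK : IsPreferential K) {a : Fm V} {s : CanonicalState K}
    (hs : a.eval s.world = true) (h : AsNormal K s.fm a) :
    MinIn lt {t : CanonicalState K | a.eval t.world = true} s :=
  ⟨hs, fun t ht hts => by
    have := hK.eval_of_asNormal_of_asNormal hts.1 h t.normalWorld ht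
    simp [hts.2] at this⟩

theorem exists_lt (hK : IsPreferential K) {a : Fm V} {s : CanonicalState K}
    (h : ¬ AsNormal K s.fm a) :
    ∃ t, MinIn lt {t : CanonicalState K | a.eval t.world = true} t ∧ lt t s := by
  obtain ⟨w, hw, hsw⟩ := hK.exists_normalWorld h
  obtain ⟨t, rfl, ht⟩ := exists_mk hK hw
  have hor := hK.eval_of_normalWorld hw
  have hle : ∀ b, (∀ v, b.eval v = true → (s.fm.disj a).eval v = true) → AsNormal K t.fm b := by
    intro b hb
    refine hK.weaken (hK.refl _) fun v => ?_
    have h₁ := hb v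
    have h₂ := ht v
    grind [Fm.eval]
  exact ⟨t, minIn_of_asNormal hK (by simpa [Fm.eval, hsw] using hor)
    (hle a fun v hv => by simp [Fm.eval, hv]), hle s.fm fun v hv => by simp [Fm.eval, hv], hsw⟩

end CanonicalState

/-- The canonical model of a preferential consequence relation. -/
noncomputable def IsPreferential.canonicalModel {K : CRel V} (hK : IsPreferential K) :
    PrefModel V where
  S := CanonicalState K
  l := CanonicalState.world
  lt := CanonicalState.lt
  irrefl s h := by
    have := hK.eval_of_normalWorld s.normalWorld
    simp [h.2] at this
  trans s t u hst htu := by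
    refine ⟨hK.asNormal_trans hst.1 htu.1, ?_⟩
    by_contra hu
    have := hK.eval_of_asNormal_of_asNormal hst.1 htu.1 s.normalWorld
      (Bool.eq_true_of_not_eq_false hu)
    simp [hst.2] at this
  smooth a s hs := by
    by_cases h : AsNormal K s.fm a
    · exact .inl (CanonicalState.minIn_of_asNormal hK hs h)
    · exact .inr (CanonicalState.exists_lt hK h)

theorem IsPreferential.rel_canonicalModel {K : CRel V} (hK : IsPreferential K) :
    K = hK.canonicalModel.Rel := by
  ext ⟨a, b⟩
  constructor
  · intro hab s hs
    have hle : AsNormal K (CanonicalState.fm s) a := by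
      by_contra h
      obtain ⟨t, ht, hts⟩ := CanonicalState.exists_lt hK h
      exact hs.2 t ht.1 hts
    exact hK.normalWorld_of_asNormal hle (CanonicalState.normalWorld s) hs.1 b hab
  · intro hab
    by_contra h
    obtain ⟨w, hw, hb⟩ := hK.exists_normalWorld h
    obtain ⟨s, rfl, hs⟩ := CanonicalState.exists_mk hK hw
    have hmin := CanonicalState.minIn_of_asNormal hK (hK.eval_of_normalWorld hw)
      (hK.weaken (hK.refl _) fun v => by have := hs v; grind [Fm.eval])
    have := hab s hmin
    exact Bool.false_ne_true (hb.symm.trans this)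

/-- Representation theorem: a relation is preferential iff defined by some
preferential model; over a logically finite language, by a finite one. -/
theorem stmt0 (V : Type) :
    (∀ K : CRel V, IsPreferential K ↔ ∃ W : PrefModel V, K = W.Rel) ∧
    (Finite V → ∀ K : CRel V, IsPreferential K →
      ∃ W : PrefModel V, Finite W.S ∧ K = W.Rel) := by
  refine ⟨fun K => ⟨fun hK => ⟨hK.canonicalModel, hK.rel_canonicalModel⟩, ?_⟩,
    fun _ K hK => ⟨hK.canonicalModel, ?_, hK.rel_canonicalModel⟩⟩
  · rintro ⟨W, rfl⟩
    exact W.isPreferential_rel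
  · exact inferInstanceAs (Finite (CanonicalState K))
end

section
/- There exists a preferential consequence relation (over the propositional language built on countably many propositional variables) that is not the consequence relation defined by any well-founded preferential model. Concretely, for the model with states s_i for i ∈ ω ∪ {∞}, ordered by s_i ≺ s_j iff i > j, where s_i satisfies exactly the variables p_j with j ≥ i, the defined relation satisfies p_i |~ p_{i+1} and p_{i+1} |~ ¬p_i for all i ∈ ω, and p_0 |~/ false; and no well-founded preferential model defines a relation with these properties. -/
variable {V : Type}

/-- A minimal state of a larger set is minimal in every smaller set containing it. -/
theorem MinIn.mono {S : Type} {lt : S → S → Prop} {A B : Set S} {s : S}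
    (h : MinIn lt B s) (hAB : A ⊆ B) (hs : s ∈ A) : MinIn lt A s :=
  ⟨hs, fun t ht => h.2 t (hAB ht)⟩

/-- The world satisfying exactly the variables `p_j` with `n ≤ j`; for `n = ⊤` it satisfies
no variable. -/
noncomputable def tailWorld (n : ℕ∞) (j : ℕ) : Bool := decide (n ≤ (j : ℕ∞))

/-- Along the worlds `tailWorld n`, every formula eventually takes its value at
`tailWorld ⊤`. -/
theorem Fm.exists_eval_tailWorld_eq_top (a : Fm ℕ) :
    ∃ N : ℕ, ∀ n : ℕ∞, (N : ℕ∞) < n → a.eval (tailWorld n) = a.eval (tailWorld ⊤) := by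
  have combine : ∀ a b : Fm ℕ,
      (∃ N : ℕ, ∀ n : ℕ∞, (N : ℕ∞) < n → a.eval (tailWorld n) = a.eval (tailWorld ⊤)) →
      (∃ N : ℕ, ∀ n : ℕ∞, (N : ℕ∞) < n → b.eval (tailWorld n) = b.eval (tailWorld ⊤)) →
      ∃ N : ℕ, ∀ n : ℕ∞, (N : ℕ∞) < n → a.eval (tailWorld n) = a.eval (tailWorld ⊤) ∧
        b.eval (tailWorld n) = b.eval (tailWorld ⊤) := by
    rintro a b ⟨N, hN⟩ ⟨M, hM⟩
    refine ⟨max N M, fun n hn => ⟨hN n (lt_of_le_of_lt ?_ hn), hM n (lt_of_le_of_lt ?_ hn)⟩⟩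
    · exact_mod_cast le_max_left N M
    · exact_mod_cast le_max_right N M
  induction a with
  | var v => exact ⟨v, fun n hn => by simp [Fm.eval, tailWorld, hn]⟩
  | fls => exact ⟨0, fun _ _ => rfl⟩
  | tru => exact ⟨0, fun _ _ => rfl⟩
  | neg a ih =>
    obtain ⟨N, hN⟩ := ih
    exact ⟨N, fun n hn => by simp only [Fm.eval, hN n hn]⟩
  | conj a b iha ihb | disj a b iha ihb | impl a b iha ihb | iff a b iha ihb =>
    obtain ⟨N, hN⟩ := combine a b iha ihb
    exact ⟨N, fun n hn => by simp only [Fm.eval, (hN n hn).1, (hN n hn).2]⟩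

/-- The model with states `ℕ∞` in decreasing order, state `n` being labeled by
`tailWorld n`. -/
noncomputable def descendingModel : PrefModel ℕ where
  S := ℕ∞
  l := tailWorld
  lt s t := t < s
  irrefl s := lt_irrefl s
  trans _ _ _ hst htu := htu.trans hst
  smooth a s hs := by
    suffices h : ∃ t, s ≤ t ∧ MinIn (fun s t : ℕ∞ => t < s)
        {t | a.eval (tailWorld t) = true} t by
      obtain ⟨t, hst, ht⟩ := h
      rcases hst.eq_or_lt with rfl | hlt
      · exact Or.inl ht
      · exact Or.inr ⟨t, ht, hlt⟩
    by_cases htop : a.eval (tailWorld ⊤) = true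
    · exact ⟨⊤, le_top, htop, fun _ _ => not_top_lt⟩
    · obtain ⟨N, hN⟩ := a.exists_eval_tailWorld_eq_top
      have hfin : {t : ℕ∞ | a.eval (tailWorld t) = true}.Finite := by
        refine ((Set.finite_Iic N).image ((↑) : ℕ → ℕ∞)).subset fun t ht => ?_
        have htN : t ≤ N := not_lt.mp fun hlt => htop ((hN t hlt).symm.trans ht)
        lift t to ℕ using ne_top_of_le_ne_top (ENat.natCast_ne_top N) htN
        exact ⟨t, by exact_mod_cast htN, rfl⟩
      obtain ⟨t, hst, ht⟩ := hfin.exists_le_maximal hs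
      exact ⟨t, hst, ht.prop, fun u hu => ht.not_gt hu⟩

/-- The only minimal state of `p_i` in `descendingModel` is `i`. -/
theorem minIn_descendingModel_var_iff (i : ℕ) (s : ℕ∞) :
    MinIn descendingModel.lt
      {t | (Fm.var i).eval (descendingModel.l t) = true} s ↔ s = i := by
  have hmem : ∀ t : ℕ∞, (Fm.var i).eval (descendingModel.l t) = true ↔ t ≤ i :=
    fun t => decide_eq_true_iff
  constructor
  · intro h
    exact le_antisymm ((hmem s).1 h.1) (not_lt.mp (h.2 (i : ℕ∞) ((hmem _).2 le_rfl)))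
  · rintro rfl
    exact ⟨(hmem _).2 le_rfl, fun t ht => not_lt.mpr ((hmem t).1 ht)⟩

/-- A model in which `p_i |~ p_{i+1}` and `p_{i+1} |~ ¬p_i` for all `i`, but not
`p_0 |~ false`, has an infinite descending chain. -/
theorem PrefModel.exists_descending_chain (W : PrefModel ℕ)
    (hsucc : ∀ i : ℕ, W.Sat (Fm.var i) (Fm.var (i + 1)))
    (hneg : ∀ i : ℕ, W.Sat (Fm.var (i + 1)) (Fm.neg (Fm.var i)))
    (hzero : ¬ W.Sat (Fm.var 0) Fm.fls) :
    ∃ f : ℕ → W.S, ∀ n, W.lt (f (n + 1)) (f n) := by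
  have step : ∀ (i : ℕ) (s : {s // MinIn W.lt {t | (Fm.var i).eval (W.l t) = true} s}),
      ∃ t : {t // MinIn W.lt {u | (Fm.var (i + 1)).eval (W.l u) = true} t},
        W.lt t.1 s.1 := by
    rintro i ⟨s, hs⟩
    rcases W.smooth _ s (hsucc i s hs) with hmin | ⟨t, ht, hts⟩
    · have hi : (Fm.var i).eval (W.l s) = true := hs.1
      have hni := hneg i s hmin
      rw [Fm.eval, hi] at hni
      exact absurd hni (by decide)
    · exact ⟨⟨t, ht⟩, hts⟩
  choose next hnext using step
  obtain ⟨s, hs⟩ : ∃ s, MinIn W.lt {t | (Fm.var 0).eval (W.l t) = true} s := by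
    by_contra h
    exact hzero fun s hs => absurd ⟨s, hs⟩ h
  let f : ∀ i, {s // MinIn W.lt {t | (Fm.var i).eval (W.l t) = true} s} :=
    fun i => Nat.rec ⟨s, hs⟩ next i
  exact ⟨fun i => (f i).1, fun i => hnext i (f i)⟩

/-- There is a preferential relation (with the concrete properties of the model
of Lemma le:well) defined by no well-founded preferential model. -/
theorem stmt1 :
    (∃ K : CRel ℕ, IsPreferential K ∧
      (∀ i : ℕ, (Fm.var i, Fm.var (i + 1)) ∈ K) ∧
      (∀ i : ℕ, (Fm.var (i + 1), Fm.neg (Fm.var i)) ∈ K) ∧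
      (Fm.var 0, Fm.fls) ∉ K) ∧
    (∀ W : PrefModel ℕ, W.NoInfDesc →
      ¬ ((∀ i : ℕ, W.Sat (Fm.var i) (Fm.var (i + 1))) ∧
         (∀ i : ℕ, W.Sat (Fm.var (i + 1)) (Fm.neg (Fm.var i))) ∧
         ¬ W.Sat (Fm.var 0) Fm.fls)) := by
  refine ⟨⟨descendingModel.Rel, descendingModel.isPreferential_rel, ?_, ?_, ?_⟩, ?_⟩
  · intro i s hs
    obtain rfl := (minIn_descendingModel_var_iff i s).1 hs
    exact decide_eq_true (by exact_mod_cast i.le_succ)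
  · intro i s hs
    obtain rfl := (minIn_descendingModel_var_iff (i + 1) s).1 hs
    have h : ¬ ((i + 1 : ℕ) : ℕ∞) ≤ i := by exact_mod_cast i.not_succ_le_self
    change (!decide (((i + 1 : ℕ) : ℕ∞) ≤ i)) = true
    simp only [h, decide_false, Bool.not_false]
  · intro h
    exact Bool.false_ne_true (h ((0 : ℕ) : ℕ∞) ((minIn_descendingModel_var_iff 0 _).2 rfl))
  · rintro W hW ⟨hsucc, hneg, hzero⟩
    exact hW (W.exists_descending_chain hsucc hneg hzero)
end

section
/- Compactness of preferential entailment: a set K of conditional assertions preferentially entails a conditional assertion A if and only if some finite subset of K preferentially entails A. -/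
variable {V : Type}

/-- The label of a state of an ultraproduct: a variable is true iff it is true at almost all
coordinates. -/
noncomputable abbrev ultraLabel {I : Type} (U : Ultrafilter I) (W : I → PrefModel V)
    (s : ∀ i, (W i).S) (v : V) : Bool :=
  open Classical in decide (∀ᶠ i in (U : Filter I), (W i).l (s i) v = true)

/-- Coordinatewise order modulo the ultrafilter. -/
abbrev ultraLt {I : Type} (U : Ultrafilter I) (W : I → PrefModel V) (s t : ∀ i, (W i).S) : Prop :=
  ∀ᶠ i in (U : Filter I), (W i).lt (s i) (t i)

theorem eval_ultraLabel {I : Type} (U : Ultrafilter I) (W : I → PrefModel V)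
    (s : ∀ i, (W i).S) (a : Fm V) :
    a.eval (ultraLabel U W s) = true ↔
      ∀ᶠ i in (U : Filter I), a.eval ((W i).l (s i)) = true := by
  induction a with
  | var v => simp [Fm.eval]
  | fls => simp [Fm.eval, U.neBot.ne]
  | tru => simp [Fm.eval]
  | neg a ha =>
    simp only [Fm.eval, Bool.not_eq_true', ← Bool.not_eq_true, ha, Ultrafilter.eventually_not]
  | conj a b ha hb => simp only [Fm.eval, Bool.and_eq_true, ha, hb, Filter.eventually_and]
  | disj a b ha hb => simp only [Fm.eval, Bool.or_eq_true, ha, hb, Ultrafilter.eventually_or]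
  | impl a b ha hb =>
    simp only [Fm.eval, Bool.or_eq_true, Bool.not_eq_true', ← Bool.not_eq_true, ha, hb,
      Ultrafilter.eventually_or, Ultrafilter.eventually_not]
  | iff a b ha hb =>
    have hbeq (x y : Bool) : (x == y) = true ↔ (x = true → y = true) ∧ (y = true → x = true) := by
      cases x <;> cases y <;> decide
    simp only [Fm.eval, hbeq, ha, hb, Filter.eventually_and, Ultrafilter.eventually_imp]

theorem minIn_ultraLt {I : Type} (U : Ultrafilter I) (W : I → PrefModel V)
    (s : ∀ i, (W i).S) (a : Fm V) :
    MinIn (ultraLt U W) {t | a.eval (ultraLabel U W t) = true} s ↔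
      ∀ᶠ i in (U : Filter I), MinIn (W i).lt {t | a.eval ((W i).l t) = true} (s i) := by
  constructor
  · rintro ⟨hs, hmin⟩
    by_contra hnot
    have hs' := (eval_ultraLabel U W s a).1 hs
    have hex : ∀ i, ∃ t, ¬ MinIn (W i).lt {t | a.eval ((W i).l t) = true} (s i) →
        a.eval ((W i).l (s i)) = true →
        a.eval ((W i).l t) = true ∧ (W i).lt t (s i) := by
      intro i
      by_contra! h
      exact (h (s i)).1 ⟨(h (s i)).2.1, fun t ht hlt => (h t).2.2 ht hlt⟩
    choose t ht using hex
    have hboth := (Ultrafilter.eventually_not.2 hnot).and hs'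
    exact hmin t ((eval_ultraLabel U W t a).2 (hboth.mono fun i h => (ht i h.1 h.2).1))
      (hboth.mono fun i h => (ht i h.1 h.2).2)
  · intro h
    refine ⟨(eval_ultraLabel U W s a).2 (h.mono fun i hi => hi.1), fun t ht hlt => ?_⟩
    obtain ⟨i, hi, hti, hlti⟩ := (h.and (((eval_ultraLabel U W t a).1 ht).and hlt)).exists
    exact hi.2 _ hti hlti

/-- The ultraproduct of a family of preferential models. States are kept as functions rather than
germs, which is harmless because all relations are evaluated modulo the ultrafilter. -/
noncomputable def ultraproduct {I : Type} (U : Ultrafilter I) (W : I → PrefModel V) :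
    PrefModel V where
  S := ∀ i, (W i).S
  l := ultraLabel U W
  lt := ultraLt U W
  irrefl s h := h.exists.elim fun i hi => (W i).irrefl _ hi
  trans s t u hst htu := (hst.and htu).mono fun i h => (W i).trans _ _ _ h.1 h.2
  smooth a s hs := by
    rw [or_iff_not_imp_left, minIn_ultraLt, ← Ultrafilter.eventually_not]
    intro hnot
    have hex : ∀ i, ∃ t, ¬ MinIn (W i).lt {t | a.eval ((W i).l t) = true} (s i) →
        a.eval ((W i).l (s i)) = true →
        MinIn (W i).lt {t | a.eval ((W i).l t) = true} t ∧ (W i).lt t (s i) := by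
      intro i
      by_contra! h
      obtain ⟨t, ht, hlt⟩ := ((W i).smooth a (s i) (h (s i)).2.1).resolve_left (h (s i)).1
      exact (h t).2.2 ht hlt
    choose t ht using hex
    have hboth := hnot.and ((eval_ultraLabel U W s a).1 hs)
    exact ⟨t, (minIn_ultraLt U W t a).2 (hboth.mono fun i h => (ht i h.1 h.2).1),
      hboth.mono fun i h => (ht i h.1 h.2).2⟩

theorem ultraproduct_sat {I : Type} {U : Ultrafilter I} {W : I → PrefModel V} {a b : Fm V}
    (h : ∀ᶠ i in (U : Filter I), (W i).Sat a b) : (ultraproduct U W).Sat a b := fun s hs =>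
  (eval_ultraLabel U W s b).2
    ((h.and ((minIn_ultraLt U W s a).1 hs)).mono fun i hi => hi.1 (s i) hi.2)

theorem not_ultraproduct_sat {I : Type} {U : Ultrafilter I} {W : I → PrefModel V} {a b : Fm V}
    (h : ∀ i, ¬ (W i).Sat a b) : ¬ (ultraproduct U W).Sat a b := by
  simp only [PrefModel.Sat, not_forall] at h
  choose s hs hb using h
  intro hsat
  have hev := (eval_ultraLabel U W s b).1
    (hsat s ((minIn_ultraLt U W s a).2 (Filter.Eventually.of_forall hs)))
  exact hev.exists.elim hb

/-- Compactness of preferential entailment. -/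
theorem stmt2 (V : Type) (K : CRel V) (A : Fm V × Fm V) :
    Entails K A ↔ ∃ K' ⊆ K, K'.Finite ∧ Entails K' A := by
  constructor
  · intro hK
    by_contra! hfin
    have hex (F : Finset (Fm V × Fm V)) :
        ∃ W : PrefModel V, W.Models {p ∈ K | p ∈ F} ∧ ¬ W.Sat A.1 A.2 := by
      have h := hfin {p ∈ K | p ∈ F} (Set.sep_subset _ _)
        (F.finite_toSet.subset fun p hp => hp.2)
      simpa [Entails] using h
    choose W hW hA using hex
    let U : Ultrafilter (Finset (Fm V × Fm V)) := Ultrafilter.of Filter.atTop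
    refine not_ultraproduct_sat (U := U) hA (hK _ fun p hp => ultraproduct_sat ?_)
    refine Ultrafilter.of_le Filter.atTop ?_
    filter_upwards [Filter.eventually_ge_atTop {p}] with F hF
    exact hW F p ⟨hp, hF (Finset.mem_singleton_self p)⟩
  · rintro ⟨K', hsub, -, hK'⟩ W hW
    exact hK' W fun p hp => hW p (hsub hp)
end

section
/- Every finitely generated preferential consequence relation (i.e., the preferential closure of a finite knowledge base) is the consequence relation defined by some well-founded preferential model. -/
variable {V : Type}

/-- A formula holds at `n` and at no earlier index of a sequence of worlds. -/
def FirstAt (h : ℕ → V → Bool) (a : Fm V) (n : ℕ) : Prop :=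
  a.eval (h n) = true ∧ ∀ m < n, ¬ a.eval (h m) = true

/-- The disjunction of the antecedents of a finite knowledge base is expressible. -/
lemma exists_disj_antecedents {X : CRel V} (hX : X.Finite) :
    ∃ d : Fm V, ∀ w, d.eval w = true ↔ ∃ p ∈ X, p.1.eval w = true := by
  induction X, hX using Set.Finite.induction_on with
  | empty => exact ⟨.fls, by simp [Fm.eval]⟩
  | @insert p _ _ _ ih =>
    obtain ⟨d, hd⟩ := ih
    exact ⟨.disj p.1 d, fun w => by simp only [Fm.eval, Bool.or_eq_true, hd, Set.exists_mem_insert]⟩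

/-- Weakly below a state `s` there is a state that is minimal for every antecedent of `X` it
satisfies, and it satisfies one of them unless it is `s` itself. -/
lemma PrefModel.exists_minIn_antecedents (W : PrefModel V) (s : W.S) {X : CRel V}
    (hX : X.Finite) :
    ∃ t, (t = s ∨ W.lt t s) ∧
      (∀ p ∈ X, p.1.eval (W.l t) = true → MinIn W.lt {u | p.1.eval (W.l u) = true} t) ∧
      (t = s ∨ ∃ p ∈ X, p.1.eval (W.l t) = true) := by
  by_cases h : ∃ u, W.lt u s ∧ ∃ p ∈ X, p.1.eval (W.l u) = true
  · obtain ⟨u, hus, hu⟩ := h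
    obtain ⟨d, hd⟩ := exists_disj_antecedents hX
    obtain ⟨t, ht, hts⟩ : ∃ t, MinIn W.lt {t | d.eval (W.l t) = true} t ∧ W.lt t s := by
      rcases W.smooth d u ((hd _).2 hu) with hm | ⟨t, ht, htu⟩
      · exact ⟨u, hm, hus⟩
      · exact ⟨t, ht, W.trans _ _ _ htu hus⟩
    exact ⟨t, .inr hts,
      fun p hp hpt => ⟨hpt, fun v hv => ht.2 v ((hd _).2 ⟨p, hp, hv⟩)⟩, .inr ((hd _).1 ht.1)⟩
  · exact ⟨s, .inl rfl, fun p hp hps => ⟨hps, fun v hv hvs => h ⟨v, hvs, p, hp, hv⟩⟩, .inl rfl⟩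

/-- An assertion not entailed by a finite knowledge base is refuted by a model of the knowledge
base whose states are ordered like the natural numbers. -/
lemma exists_nat_countermodel {K : CRel V} (hK : K.Finite) {A : Fm V × Fm V}
    (hA : ¬ Entails K A) :
    ∃ h : ℕ → V → Bool,
      (∀ p ∈ K, ∀ n, FirstAt h p.1 n → p.2.eval (h n) = true) ∧
      ∃ n, FirstAt h A.1 n ∧ ¬ A.2.eval (h n) = true := by
  simp only [Entails, PrefModel.Sat, not_forall] at hA
  obtain ⟨W, hW, s, hs, hsA⟩ := hA
  choose c hcs hcmin hcX using
    fun X : {X : CRel V // X ⊆ K} => W.exists_minIn_antecedents s (hK.subset X.2)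
  let X : ℕ → {X : CRel V // X ⊆ K} := fun n => Nat.rec ⟨K, subset_rfl⟩
    (fun _ X => ⟨{p ∈ X.1 | ¬ p.1.eval (W.l (c X)) = true}, fun _ hp => X.2 hp.1⟩) n
  have hXsucc : ∀ n, (X (n + 1)).1 = {p ∈ (X n).1 | ¬ p.1.eval (W.l (c (X n))) = true} :=
    fun _ => rfl
  have hXanti : Antitone fun n => (X n).1 :=
    antitone_nat_of_succ_le fun n p hp => by rw [hXsucc] at hp; exact hp.1
  have hXmem : ∀ p ∈ K, ∀ n, (∀ m < n, ¬ p.1.eval (W.l (c (X m))) = true) → p ∈ (X n).1 := by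
    intro p hp n
    induction n with
    | zero => exact fun _ => hp
    | succ n ih =>
      intro h
      rw [hXsucc]
      exact ⟨ih fun m hm => h m (by omega), h n (by omega)⟩
  have hreach : ∃ n, c (X n) = s := by
    by_contra! hne
    choose g hgX hg using fun n => (hcX (X n)).resolve_left (hne n)
    have hlt : ∀ m n, m < n → g m ≠ g n := fun m n hmn heq => by
      have hmem : g n ∈ (X (m + 1)).1 := hXanti (Nat.succ_le_of_lt hmn) (hgX n)
      rw [← heq, hXsucc] at hmem
      exact hmem.2 (hg m)
    have hinj : Function.Injective g := fun m n heq => by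
      rcases lt_trichotomy m n with h | h | h
      · exact (hlt _ _ h heq).elim
      · exact h
      · exact (hlt _ _ h heq.symm).elim
    exact Set.infinite_of_injective_forall_mem hinj (fun n => (X n).2 (hgX n)) hK
  refine ⟨fun n => W.l (c (X n)), fun p hp n hn =>
    hW p hp _ (hcmin _ p (hXmem p hp n hn.2) hn.1), ?_⟩
  classical
  have hex : ∃ n, A.1.eval (W.l (c (X n))) = true := by
    obtain ⟨n, hn⟩ := hreach
    exact ⟨n, by rw [hn]; exact hs.1⟩
  have hfind : c (X (Nat.find hex)) = s :=
    (hcs _).resolve_right (hs.2 _ (Nat.find_spec hex))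
  refine ⟨Nat.find hex, ⟨Nat.find_spec hex, fun m hm => Nat.find_min hex hm⟩, ?_⟩
  simp only [hfind]
  exact hsA

/-- The disjoint union of a family of models, each ordered like the natural numbers. -/
def natSumModel {I : Type} (h : I → ℕ → V → Bool) : PrefModel V where
  S := I × ℕ
  l s := h s.1 s.2
  lt s t := s.1 = t.1 ∧ s.2 < t.2
  irrefl s hs := lt_irrefl _ hs.2
  trans _ _ _ hst htu := ⟨hst.1.trans htu.1, hst.2.trans htu.2⟩
  smooth a := by
    rintro ⟨i, n⟩ hn
    classical
    have hex : ∃ m, a.eval (h i m) = true := ⟨n, hn⟩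
    have hmin : MinIn (fun s t : I × ℕ => s.1 = t.1 ∧ s.2 < t.2)
        {t | a.eval (h t.1 t.2) = true} (i, Nat.find hex) := by
      refine ⟨Nat.find_spec hex, ?_⟩
      rintro ⟨j, m⟩ hm ⟨rfl, hlt⟩
      exact Nat.find_min hex hlt hm
    rcases (Nat.find_min' hex hn).eq_or_lt with heq | hlt
    · rw [heq] at hmin
      exact .inl hmin
    · exact .inr ⟨_, hmin, rfl, hlt⟩

lemma natSumModel_noInfDesc {I : Type} (h : I → ℕ → V → Bool) : (natSumModel h).NoInfDesc := by
  rintro ⟨f, hf⟩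
  have hwf : WellFounded (natSumModel h).lt :=
    Subrelation.wf (fun hst => hst.2) (InvImage.wf Prod.snd Nat.lt_wfRel.wf)
  exact (wellFounded_iff_isEmpty_descending_chain.1 hwf).elim ⟨f, hf⟩

lemma natSumModel_sat_iff {I : Type} (h : I → ℕ → V → Bool) (a b : Fm V) :
    (natSumModel h).Sat a b ↔ ∀ i n, FirstAt (h i) a n → b.eval (h i n) = true := by
  constructor
  · intro hsat i n hn
    refine hsat (i, n) ⟨hn.1, ?_⟩
    rintro ⟨j, m⟩ hm ⟨rfl, hlt⟩
    exact hn.2 m hlt hm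
  · rintro hsat ⟨i, n⟩ hn
    exact hsat i n ⟨hn.1, fun m hm ha => hn.2 (i, m) ha ⟨rfl, hm⟩⟩

/-- Every finitely generated preferential relation is defined by some
well-founded preferential model. -/
theorem stmt3 (V : Type) (K : CRel V) (hK : K.Finite) :
    ∃ W : PrefModel V, W.NoInfDesc ∧ PrefClosure K = W.Rel := by
  choose h hmod href using fun A : {A // ¬ Entails K A} => exists_nat_countermodel hK A.2
  refine ⟨natSumModel h, natSumModel_noInfDesc h, Set.Subset.antisymm ?_ ?_⟩
  · exact fun A hA => hA _ fun p hp =>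
      (natSumModel_sat_iff h p.1 p.2).2 fun i n hn => hmod i p hp n hn
  · intro A hA
    by_contra hnot
    obtain ⟨n, hn, hfalse⟩ := href ⟨A, hnot⟩
    exact hfalse ((natSumModel_sat_iff h A.1 A.2).1 hA ⟨A, hnot⟩ n hn)
end

section
/- Let K be a knowledge base and α |~ β a conditional assertion that is not preferentially entailed by K. Then for every formula γ, the assertion γ |~ false is preferentially entailed by K ∪ {α |~ ¬β} if and only if γ |~ false is preferentially entailed by K. -/
variable {V : Type}

namespace PrefModel

/-- The disjoint union of two preferential models. -/
def disjointSum (W₁ W₂ : PrefModel V) : PrefModel V where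
  S := W₁.S ⊕ W₂.S
  l := Sum.elim W₁.l W₂.l
  lt := Sum.LiftRel W₁.lt W₂.lt
  irrefl := by
    rintro (s | s) h
    · exact W₁.irrefl s (Sum.liftRel_inl_inl.1 h)
    · exact W₂.irrefl s (Sum.liftRel_inr_inr.1 h)
  trans := by
    rintro _ _ _ (⟨h⟩ | ⟨h⟩) (⟨h'⟩ | ⟨h'⟩)
    · exact .inl (W₁.trans _ _ _ h h')
    · exact .inr (W₂.trans _ _ _ h h')
  smooth := by
    rintro a (s | s) hs
    · rcases W₁.smooth a s hs with h | ⟨t, h, hts⟩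
      · refine .inl ⟨hs, ?_⟩
        rintro _ hu ⟨hus⟩
        exact h.2 _ hu hus
      · refine .inr ⟨.inl t, ⟨h.1, ?_⟩, .inl hts⟩
        rintro _ hu ⟨hut⟩
        exact h.2 _ hu hut
    · rcases W₂.smooth a s hs with h | ⟨t, h, hts⟩
      · refine .inl ⟨hs, ?_⟩
        rintro _ hu (_ | hus)
        exact h.2 _ hu hus
      · refine .inr ⟨.inr t, ⟨h.1, ?_⟩, .inr hts⟩
        rintro _ hu (_ | hut)
        exact h.2 _ hu hut

theorem Models.disjointSum {W₁ W₂ : PrefModel V} {K : CRel V} (h₁ : W₁.Models K)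
    (h₂ : W₂.Models K) : (W₁.disjointSum W₂).Models K := by
  rintro p hp (s | s) hs
  · exact h₁ p hp s ⟨hs.1, fun t ht hts => hs.2 (.inl t) ht (.inl hts)⟩
  · exact h₂ p hp s ⟨hs.1, fun t ht hts => hs.2 (.inr t) ht (.inr hts)⟩

/-- `s` lies weakly below `m`. -/
def Below (W : PrefModel V) (m s : W.S) : Prop := s = m ∨ W.lt s m

theorem Below.of_lt {W : PrefModel V} {m s t : W.S} (h : W.Below m t) (hst : W.lt s t) :
    W.Below m s := by
  rcases h with rfl | h
  · exact .inr hst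
  · exact .inr (W.trans _ _ _ hst h)

/-- The order obtained by moving every state weakly below `m` under all other states. -/
def LowerLt (W : PrefModel V) (m s t : W.S) : Prop :=
  W.lt s t ∨ (W.Below m s ∧ ¬ W.Below m t)

theorem minIn_lowerLt_of_below {W : PrefModel V} {m s : W.S} {A : Set W.S}
    (hs : MinIn W.lt A s) (hb : W.Below m s) : MinIn (W.LowerLt m) A s :=
  ⟨hs.1, fun t ht h => h.elim (hs.2 t ht) fun h => h.2 hb⟩

theorem minIn_lowerLt_of_forall_not_below {W : PrefModel V} {m s : W.S} {A : Set W.S}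
    (hs : MinIn W.lt A s) (hA : ∀ t ∈ A, ¬ W.Below m t) : MinIn (W.LowerLt m) A s :=
  ⟨hs.1, fun t ht h => h.elim (hs.2 t ht) fun h => hA t ht h.1⟩

/-- The model obtained by moving every state weakly below `m` under all other states. -/
def lower (W : PrefModel V) (m : W.S) : PrefModel V where
  S := W.S
  l := W.l
  lt := W.LowerLt m
  irrefl s h := h.elim (W.irrefl s) fun h => h.2 h.1
  trans s t u := by
    rintro (h | h) (h' | h')
    · exact .inl (W.trans _ _ _ h h')
    · exact .inr ⟨h'.1.of_lt h, h'.2⟩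
    · exact .inr ⟨h.1, fun hu => h.2 (hu.of_lt h')⟩
    · exact (h.2 h'.1).elim
  smooth a s hs := by
    by_cases hA : ∀ t ∈ {t | a.eval (W.l t) = true}, ¬ W.Below m t
    · rcases W.smooth a s hs with h | ⟨t, h, hts⟩
      · exact .inl (minIn_lowerLt_of_forall_not_below h hA)
      · exact .inr ⟨t, minIn_lowerLt_of_forall_not_below h hA, .inl hts⟩
    · push Not at hA
      obtain ⟨t, hta, htm⟩ := hA
      by_cases hsm : W.Below m s
      · rcases W.smooth a s hs with h | ⟨u, h, hus⟩
        · exact .inl (minIn_lowerLt_of_below h hsm)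
        · exact .inr ⟨u, minIn_lowerLt_of_below h (hsm.of_lt hus), .inl hus⟩
      · rcases W.smooth a t hta with h | ⟨u, h, hut⟩
        · exact .inr ⟨t, minIn_lowerLt_of_below h htm, .inr ⟨htm, hsm⟩⟩
        · have hum := htm.of_lt hut
          exact .inr ⟨u, minIn_lowerLt_of_below h hum, .inr ⟨hum, hsm⟩⟩

theorem Models.lower {W : PrefModel V} {K : CRel V} (h : W.Models K) (m : W.S) :
    (W.lower m).Models K :=
  fun p hp s hs => h p hp s ⟨hs.1, fun t ht hts => hs.2 t ht (.inl hts)⟩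

theorem eq_of_minIn_lower {W : PrefModel V} {m s : W.S} {A : Set W.S}
    (hm : MinIn W.lt A m) (hs : MinIn (W.lower m).lt A s) : s = m := by
  by_contra hne
  exact hs.2 m hm.1 (.inr ⟨.inl rfl, fun h => h.elim hne (hm.2 s hs.1)⟩)

theorem sat_fls_iff {W : PrefModel V} {c : Fm V} :
    W.Sat c Fm.fls ↔ ∀ s, c.eval (W.l s) ≠ true := by
  constructor
  · intro h s hs
    rcases W.smooth c s hs with hm | ⟨t, hm, -⟩
    · exact Bool.false_ne_true (h s hm)
    · exact Bool.false_ne_true (h t hm)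
  · exact fun h s hs => (h s hs.1).elim

end PrefModel

/-- If α |~ β is not preferentially entailed by K, then K ∪ {α |~ ¬β} and K
have the same inconsistent formulas. -/
theorem stmt4 (V : Type) (K : CRel V) (a b : Fm V) (h : ¬ Entails K (a, b))
    (c : Fm V) :
    Entails (K ∪ {(a, b.neg)}) (c, Fm.fls) ↔ Entails K (c, Fm.fls) := by
  refine ⟨fun hc W hW => ?_, fun hc W hW => hc W fun p hp => hW p (.inl hp)⟩
  simp only [Entails, PrefModel.Sat, not_forall] at h
  obtain ⟨W₀, hW₀, m, hm, hmb⟩ := h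
  have hm' : MinIn (W₀.disjointSum W).lt
      {t | a.eval ((W₀.disjointSum W).l t) = true} (.inl m) := by
    refine ⟨hm.1, ?_⟩
    rintro _ ht ⟨htm⟩
    exact hm.2 _ ht htm
  have hmodels : ((W₀.disjointSum W).lower (.inl m)).Models (K ∪ {(a, b.neg)}) := by
    rintro p (hp | rfl)
    · exact (hW₀.disjointSum hW).lower _ p hp
    · intro s hs
      obtain rfl := PrefModel.eq_of_minIn_lower hm' hs
      change (!(b.eval (W₀.l m))) = true
      simpa using hmb
  have hno := PrefModel.sat_fls_iff.1 (hc _ hmodels)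
  exact PrefModel.sat_fls_iff.2 fun s => hno (.inr s)
end

section
/- Let K be a knowledge base and α |~ β a conditional assertion. Then α |~ β is preferentially entailed by K if and only if the assertion α |~ false is preferentially entailed by K ∪ {α |~ ¬β}. -/
variable {V : Type}

/-- The submodel of `W` consisting of the states at or below `s`. -/
def PrefModel.below (W : PrefModel V) (s : W.S) : PrefModel V where
  S := {t : W.S // t = s ∨ W.lt t s}
  l t := W.l t.1
  lt t u := W.lt t.1 u.1
  irrefl t := W.irrefl t.1
  trans t u v := W.trans t.1 u.1 v.1
  smooth := by
    rintro c ⟨t, ht⟩ hc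
    rcases W.smooth c t hc with h | ⟨u, hu, hut⟩
    · exact Or.inl ⟨hc, fun v hv => h.2 v.1 hv⟩
    · have hus : W.lt u s := by
        rcases ht with rfl | ht
        · exact hut
        · exact W.trans _ _ _ hut ht
      exact Or.inr ⟨⟨u, Or.inr hus⟩, ⟨hu.1, fun v hv => hu.2 v.1 hv⟩, hut⟩

theorem PrefModel.Sat.below {W : PrefModel V} {c d : Fm V} (h : W.Sat c d) (s : W.S) :
    (W.below s).Sat c d := by
  rintro ⟨t, ht⟩ ⟨hc, hmin⟩
  refine h t ⟨hc, fun u hu hut => ?_⟩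
  have hus : W.lt u s := by
    rcases ht with rfl | ht
    · exact hut
    · exact W.trans _ _ _ hut ht
  exact hmin ⟨u, Or.inr hus⟩ hu hut

/-- α |~ β is preferentially entailed by K iff α |~ false is preferentially
entailed by K ∪ {α |~ ¬β}. -/
theorem stmt5 (V : Type) (K : CRel V) (a b : Fm V) :
    Entails K (a, b) ↔ Entails (K ∪ {(a, b.neg)}) (a, Fm.fls) := by
  constructor
  · intro h W hW s hs
    have hb := h W (fun p hp => hW p (Or.inl hp)) s hs
    have hn := hW (a, b.neg) (Or.inr rfl) s hs
    simp_all [Fm.eval]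
  · intro h W hW s hs
    by_contra hb
    have hmodels : (W.below s).Models (K ∪ {(a, b.neg)}) := by
      rintro p (hp | rfl)
      · exact (hW p hp).below s
      · rintro ⟨t, rfl | ht⟩ hmin
        · simpa [Fm.eval, PrefModel.below] using hb
        · exact absurd ht (hs.2 t hmin.1)
    have hfls := h (W.below s) hmodels ⟨s, Or.inl rfl⟩
      ⟨hs.1, fun u hu => hs.2 u.1 hu⟩
    simp [Fm.eval] at hfls
end

section
/- Fundamental lemma on ranks: let K be a knowledge base, let (C_τ) be its exceptionality hierarchy, let τ be an ordinal, and let A be a conditional assertion whose antecedent has rank greater than or equal to τ (or has no rank) with respect to K. Then A is preferentially entailed by C_0 = K if and only if A is preferentially entailed by C_τ. -/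
variable {V : Type}

/-- The labels of the globally minimal states of the preferential models of `K`. -/
def normalWorlds (K : CRel V) : Set (V → Bool) :=
  {w | ∃ W : PrefModel V, W.Models K ∧ ∃ s, (∀ t, ¬ W.lt t s) ∧ W.l s = w}

theorem exceptional_iff_forall_normalWorlds {K : CRel V} {a : Fm V} :
    Exceptional K a ↔ ∀ w ∈ normalWorlds K, a.eval w ≠ true := by
  constructor
  · rintro h w ⟨W, hW, s, hs, rfl⟩
    simpa [Fm.eval] using h W hW s ⟨rfl, fun t _ => hs t⟩
  · intro h W hW s hs
    simpa [Fm.eval] using h _ ⟨W, hW, s, fun t => hs.2 t rfl, rfl⟩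

theorem eval_snd_of_mem_normalWorlds {K : CRel V} {w : V → Bool} (hw : w ∈ normalWorlds K)
    {p : Fm V × Fm V} (hp : p ∈ K) (h : p.1.eval w = true) : p.2.eval w = true := by
  obtain ⟨W, hW, s, hs, rfl⟩ := hw
  exact hW p hp s ⟨h, fun t _ => hs t⟩

theorem mem_Cseq_iff {K : CRel V} {τ : Ordinal.{0}} {p : Fm V × Fm V} :
    p ∈ Cseq K τ ↔ p ∈ K ∧ ∀ ρ < τ, Exceptional (Cseq K ρ) p.1 := by
  induction τ using Ordinal.limitRecOn with
  | zero => simp [Cseq]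
  | add_one τ ih =>
    have hsucc : Cseq K (τ + 1) = ESet (Cseq K τ) := by simp [Cseq]
    rw [hsucc, ESet, Set.mem_ofPred_eq, ih, and_assoc]
    simp only [Order.lt_add_one_iff, le_iff_lt_or_eq, or_imp, forall_and, forall_eq]
  | limit τ hτ ih =>
    have hlim : Cseq K τ = ⋂ ρ : Set.Iio τ, Cseq K ρ.1 := by
      simp only [Cseq]
      rw [Ordinal.limitRecOn_limit _ _ _ _ hτ]
    simp only [hlim, Set.mem_iInter, Subtype.forall, Set.mem_Iio]
    constructor
    · intro h
      refine ⟨((ih 0 hτ.bot_lt).1 (h 0 hτ.bot_lt)).1, fun ρ hρ => ?_⟩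
      have hρ' := hτ.succ_lt hρ
      exact ((ih _ hρ').1 (h _ hρ')).2 ρ (Order.lt_succ ρ)
    · rintro ⟨hK, h⟩ ρ hρ
      exact (ih ρ hρ).2 ⟨hK, fun σ hσ => h σ (hσ.trans hρ)⟩

/-- The model `W` with well-ordered layers of worlds `L i` placed below all of its states. -/
def PrefModel.addLayers {I : Type} [LinearOrder I] [WellFoundedLT I] (L : I → Set (V → Bool))
    (W : PrefModel V) : PrefModel V where
  S := {x : I × (V → Bool) // x.2 ∈ L x.1} ⊕ W.S
  l := Sum.elim (fun x => x.1.2) W.l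
  lt := Sum.Lex (fun x y => x.1.1 < y.1.1) W.lt
  irrefl := by
    rintro (x | s) h
    · exact lt_irrefl _ (Sum.lex_inl_inl.1 h :)
    · exact W.irrefl s (Sum.lex_inr_inr.1 h)
  trans := by
    rintro _ _ _ (h | h | h) (h' | h' | h')
    · exact .inl (lt_trans h h')
    · exact .sep _ _
    · exact .inr (W.trans _ _ _ h h')
    · exact .sep _ _
  smooth := by
    intro a s hs
    by_cases hL : ∃ i, ∃ w ∈ L i, a.eval w = true
    · obtain ⟨i, ⟨w, hw, ha⟩, hi⟩ := WellFounded.has_min (wellFounded_lt (α := I))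
        {i | ∃ w ∈ L i, a.eval w = true} hL
      have hmin : ∀ x : {x : I × (V → Bool) // x.2 ∈ L x.1}, x.1.1 = i → a.eval x.1.2 = true →
          MinIn (Sum.Lex (fun x y => x.1.1 < y.1.1) W.lt)
            {t : {x : I × (V → Bool) // x.2 ∈ L x.1} ⊕ W.S |
              a.eval (Sum.elim (fun x => x.1.2) W.l t) = true} (.inl x) := by
        rintro x rfl hx
        refine ⟨hx, ?_⟩
        rintro (y | t) hy hlt
        · exact hi _ ⟨_, y.2, hy⟩ (Sum.lex_inl_inl.1 hlt :)
        · exact Sum.lex_inr_inl hlt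
      rcases s with x | s
      · rcases (not_lt.1 (hi _ ⟨_, x.2, hs⟩)).eq_or_lt with h | h
        · exact .inl (hmin x h.symm hs)
        · exact .inr ⟨.inl ⟨(i, w), hw⟩, hmin _ rfl ha, .inl h⟩
      · exact .inr ⟨.inl ⟨(i, w), hw⟩, hmin _ rfl ha, .sep _ _⟩
    · push Not at hL
      have hmin : ∀ t, MinIn W.lt {t | a.eval (W.l t) = true} t →
          MinIn (Sum.Lex (fun x y => x.1.1 < y.1.1) W.lt)
            {t : {x : I × (V → Bool) // x.2 ∈ L x.1} ⊕ W.S |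
              a.eval (Sum.elim (fun x => x.1.2) W.l t) = true} (.inr t) := by
        rintro t ⟨ht, ht'⟩
        refine ⟨ht, ?_⟩
        rintro (y | u) hu hlt
        · exact hL _ _ y.2 hu
        · exact ht' u hu (Sum.lex_inr_inr.1 hlt)
      rcases s with x | s
      · exact absurd hs (hL _ _ x.2)
      · rcases W.smooth a s hs with h | ⟨t, ht, hts⟩
        · exact .inl (hmin s h)
        · exact .inr ⟨.inr t, hmin t ht, .inr hts⟩

theorem PrefModel.sat_addLayers_iff {I : Type} [LinearOrder I] [WellFoundedLT I]
    {L : I → Set (V → Bool)} {W : PrefModel V} {a b : Fm V} :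
    (W.addLayers L).Sat a b ↔
      (∀ i, ∀ w ∈ L i, a.eval w = true → (∀ j < i, ∀ v ∈ L j, a.eval v ≠ true) →
        b.eval w = true) ∧
      ((∀ i, ∀ w ∈ L i, a.eval w ≠ true) → W.Sat a b) := by
  constructor
  · intro h
    refine ⟨fun i w hw ha hlt => h (.inl ⟨(i, w), hw⟩) ⟨ha, ?_⟩,
      fun hL s hs => h (.inr s) ⟨hs.1, ?_⟩⟩
    · rintro (y | t) hy hyx
      · exact hlt _ (Sum.lex_inl_inl.1 hyx :) _ y.2 hy
      · exact Sum.lex_inr_inl hyx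
    · rintro (y | t) hy hys
      · exact hL _ _ y.2 hy
      · exact hs.2 t hy (Sum.lex_inr_inr.1 hys)
  · rintro ⟨h₁, h₂⟩ (x | s) ⟨hs, hmin⟩
    · exact h₁ _ _ x.2 hs fun j hj v hv hav =>
        hmin (.inl ⟨(j, v), hv⟩) hav (.inl hj)
    · exact h₂ (fun i w hw haw => hmin (.inl ⟨(i, w), hw⟩) haw (.sep _ _)) s
        ⟨hs, fun t ht hts => hmin (.inr t) ht (.inr hts)⟩

/-- Fundamental lemma on ranks: if the antecedent of A has rank ≥ τ (or no
rank), i.e. is exceptional for every C_ρ with ρ < τ, then A is preferentially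
entailed by C₀ = K iff it is preferentially entailed by C_τ. -/
theorem stmt6 (V : Type) (K : CRel V) (τ : Ordinal.{0}) (A : Fm V × Fm V)
    (h : ∀ ρ < τ, Exceptional (Cseq K ρ) A.1) :
    Entails K A ↔ Entails (Cseq K τ) A := by
  refine ⟨fun hA W hW => ?_, fun hA W hW => hA W fun p hp => hW p (mem_Cseq_iff.1 hp).1⟩
  let e : τ.ToType ≃o Set.Iio τ := Ordinal.ToType.mk.symm
  let L : τ.ToType → Set (V → Bool) := fun i => normalWorlds (Cseq K (e i).1)
  have hexc : ∀ ρ (hρ : ρ < τ) (a : Fm V),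
      (∀ w ∈ L (e.symm ⟨ρ, hρ⟩), a.eval w ≠ true) → Exceptional (Cseq K ρ) a := by
    intro ρ hρ a ha
    rw [exceptional_iff_forall_normalWorlds]
    simpa [L] using ha
  have hmodels : (W.addLayers L).Models K := by
    refine fun p hp => PrefModel.sat_addLayers_iff.2 ⟨fun i w hw ha hlt => ?_, fun hL => ?_⟩
    · refine eval_snd_of_mem_normalWorlds hw (mem_Cseq_iff.2 ⟨hp, fun ρ hρ => ?_⟩) ha
      exact hexc ρ (hρ.trans (e i).2) _ (hlt _ (e.symm_apply_lt.2 hρ))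
    · exact hW p (mem_Cseq_iff.2 ⟨hp, fun ρ hρ => hexc ρ hρ _ (hL _)⟩)
  exact (PrefModel.sat_addLayers_iff.1 (hA _ hmodels)).2 fun i =>
    exceptional_iff_forall_normalWorlds.1 (h _ (e i).2)
end

section
/- If the preferential closure K^p of a knowledge base K is the consequence relation defined by some well-founded preferential model, then K is admissible (every formula having no rank for K is inconsistent for K). In particular, every finite knowledge base is admissible. -/
variable {V : Type}

theorem Cseq_zero (K : CRel V) : Cseq K 0 = K :=
  Ordinal.limitRecOn_zero ..

theorem Cseq_add_one (K : CRel V) (τ : Ordinal.{0}) : Cseq K (τ + 1) = ESet (Cseq K τ) :=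
  Ordinal.limitRecOn_add_one ..

theorem Cseq_limit (K : CRel V) {τ : Ordinal.{0}} (hτ : Order.IsSuccLimit τ) :
    Cseq K τ = ⋂ ρ : Set.Iio τ, Cseq K ρ.1 :=
  Ordinal.limitRecOn_limit _ _ _ _ hτ

theorem Cseq_antitone (K : CRel V) : Antitone (Cseq K) := by
  intro τ σ
  induction σ using Ordinal.limitRecOn with
  | zero =>
    intro h
    rw [le_antisymm h (zero_le)]
  | add_one σ ih =>
    intro h
    rcases h.eq_or_lt with rfl | h
    · exact le_rfl
    · exact (Cseq_add_one K σ).trans_subset (Set.sep_subset _ _) |>.trans (ih (Order.lt_add_one_iff.1 h))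
  | limit σ hσ ih =>
    intro h
    rcases h.eq_or_lt with rfl | h
    · exact le_rfl
    · rw [Cseq_limit K hσ]
      exact Set.iInter_subset (fun ρ : Set.Iio σ => Cseq K ρ.1) ⟨τ, h⟩

theorem Cseq_subset (K : CRel V) (τ : Ordinal.{0}) : Cseq K τ ⊆ K :=
  (Cseq_antitone K zero_le).trans_eq (Cseq_zero K)

/-- The exceptionality hierarchy stabilizes. -/
theorem exists_ESet_Cseq_eq (K : CRel V) : ∃ τ, ESet (Cseq K τ) = Cseq K τ := by
  have h : ¬ Function.Injective (Cseq K) := not_injective_of_ordinal _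
  simp only [Function.Injective, not_forall] at h
  obtain ⟨τ, σ, heq, hne⟩ := h
  wlog hlt : τ < σ generalizing τ σ
  · exact this σ τ heq.symm (Ne.symm hne) (lt_of_le_of_ne (not_lt.1 hlt) (Ne.symm hne))
  have h := Cseq_antitone K (Order.add_one_le_of_lt hlt)
  rw [← heq, Cseq_add_one] at h
  exact ⟨τ, (Set.sep_subset _ _).antisymm h⟩

/-- The preferential model with a single state, labeled by the world `w`. -/
def PrefModel.single (w : V → Bool) : PrefModel V where
  S := Unit
  l _ := w
  lt _ _ := False
  irrefl _ := id
  trans _ _ _ h _ := h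
  smooth _ _ h := Or.inl ⟨h, fun _ _ => id⟩

theorem PrefModel.single_sat (w : V → Bool) (a b : Fm V) :
    (PrefModel.single w).Sat a b ↔ (a.eval w = true → b.eval w = true) :=
  ⟨fun h ha => h () ⟨ha, fun _ _ => id⟩, fun h _ hs => h hs.1⟩

theorem Exceptional.eval_eq_false {C : CRel V} {a : Fm V} (h : Exceptional C a) {w : V → Bool}
    (hw : ∀ p ∈ C, p.1.eval w = true → p.2.eval w = true) : a.eval w = false := by
  have := h (PrefModel.single w) fun p hp => (PrefModel.single_sat w _ _).2 (hw p hp)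
  simpa [PrefModel.single_sat, Fm.eval] using this

/-- If all antecedents of `C` as well as `a` are exceptional for `C`, then, in a model of `C`, no
state is minimal among those satisfying `a` or an antecedent of `C`. -/
theorem PrefModel.Models.not_minIn {W : PrefModel V} {C : CRel V} (hW : W.Models C)
    (hC : ∀ p ∈ C, Exceptional C p.1) {a : Fm V} (ha : Exceptional C a) (s : W.S) :
    ¬ MinIn W.lt {t | a.eval (W.l t) = true ∨ ∃ p ∈ C, p.1.eval (W.l t) = true} s := by
  rintro ⟨hs, hmin⟩
  have hw : ∀ p ∈ C, p.1.eval (W.l s) = true → p.2.eval (W.l s) = true := fun p hp h =>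
    hW p hp s ⟨h, fun t ht => hmin t (Or.inr ⟨p, hp, ht⟩)⟩
  rcases hs with h | ⟨p, hp, h⟩
  · simp [ha.eval_eq_false hw] at h
  · simp [(hC p hp).eval_eq_false hw] at h

/-- A formula without rank is satisfied by no state of a model of `K` in which each nonempty set of
states given by that formula and antecedents from a subset of `K` has a minimal element. -/
theorem PrefModel.Models.eval_eq_false_of_not_hasRank {W : PrefModel V} {K : CRel V}
    (hW : W.Models K) {a : Fm V} (ha : ¬ HasRank K a)
    (hmin : ∀ C ⊆ K, ∀ s, a.eval (W.l s) = true →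
      ∃ t, MinIn W.lt {t | a.eval (W.l t) = true ∨ ∃ p ∈ C, p.1.eval (W.l t) = true} t)
    (s : W.S) : a.eval (W.l s) = false := by
  obtain ⟨τ, hτ⟩ := exists_ESet_Cseq_eq K
  have hsub := Cseq_subset K τ
  by_contra hs
  obtain ⟨t, ht⟩ := hmin _ hsub s (by simpa using hs)
  refine PrefModel.Models.not_minIn (fun p hp => hW p (hsub hp)) (fun p hp => ?_) ?_ t ht
  · rw [← hτ] at hp
    exact hp.2
  · by_contra h
    exact ha ⟨τ, h⟩

theorem PrefModel.NoInfDesc.exists_minIn {W : PrefModel V} (hW : W.NoInfDesc) {A : Set W.S}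
    (hA : A.Nonempty) : ∃ s, MinIn W.lt A s := by
  by_contra! h
  simp only [MinIn, not_and, not_forall, not_not] at h
  obtain ⟨s, hs⟩ := hA
  choose g hg hlt using h
  let f : ℕ → A := fun n => n.rec ⟨s, hs⟩ fun _ x => ⟨g x.1 x.2, hg x.1 x.2⟩
  exact hW ⟨fun n => (f n).1, fun n => hlt (f n).1 (f n).2⟩

theorem PrefModel.exists_minIn (W : PrefModel V) (a : Fm V) {s : W.S}
    (hs : a.eval (W.l s) = true) : ∃ t, MinIn W.lt {t | a.eval (W.l t) = true} t := by
  rcases W.smooth a s hs with h | ⟨t, ht, -⟩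
  exacts [⟨s, h⟩, ⟨t, ht⟩]

/-- Finite disjunctions of formulas exist. -/
theorem exists_eval_iff_of_finite (a : Fm V) {C : CRel V} (hC : C.Finite) :
    ∃ d : Fm V, ∀ w, d.eval w = true ↔ a.eval w = true ∨ ∃ p ∈ C, p.1.eval w = true := by
  induction C, hC using Set.Finite.induction_on with
  | empty => exact ⟨a, by simp⟩
  | @insert p C _ _ ih =>
    obtain ⟨d, hd⟩ := ih
    refine ⟨p.1.disj d, fun w => ?_⟩
    rw [Fm.eval, Bool.or_eq_true, hd, Set.exists_mem_insert, or_left_comm]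

/-- If K^p is defined by a well-founded preferential model then K is
admissible; in particular, every finite knowledge base is admissible. -/
theorem stmt7 (V : Type) :
    (∀ K : CRel V,
      (∃ W : PrefModel V, W.NoInfDesc ∧ PrefClosure K = W.Rel) → Admissible K) ∧
    (∀ K : CRel V, K.Finite → Admissible K) := by
  refine ⟨fun K ⟨W, hwf, hK⟩ a ha => ?_, fun K hK a ha W hW s hs => ?_⟩
  · have hW : W.Models K := fun p hp => by
      have : p ∈ PrefClosure K := fun W' h => h p hp
      rwa [hK] at this
    change (a, Fm.fls) ∈ PrefClosure K
    rw [hK]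
    intro s hs
    have := hW.eval_eq_false_of_not_hasRank ha
      (fun C _ t ht => hwf.exists_minIn ⟨t, Or.inl ht⟩) s
    exact absurd (hs.1.symm.trans this) (by simp)
  · have := hW.eval_eq_false_of_not_hasRank ha (fun C hC t ht => by
      obtain ⟨d, hd⟩ := exists_eval_iff_of_finite a (hK.subset hC)
      simp only [← hd]
      exact W.exists_minIn d ((hd _).2 (Or.inl ht))) s
    exact absurd (hs.1.symm.trans this) (by simp)
end

section
/- Any preferential consequence relation that satisfies Disjunctive Rationality also satisfies Negation Rationality. -/
variable {V : Type}

/-- Any preferential relation satisfying Disjunctive Rationality satisfies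
Negation Rationality. -/
theorem stmt8 (V : Type) (K : CRel V) (hp : IsPreferential K)
    (hd : DisjunctiveRationality K) : NegationRationality K := by
  intro a b c h₁ h₂ h
  refine hd _ _ _ h₁ h₂ (hp.2.1 a _ b (fun w => ?_) h)
  cases ha : a.eval w <;> cases hc : c.eval w <;> simp [Fm.eval, ha, hc]
end

section
/- Every rational consequence relation satisfies Disjunctive Rationality. -/
variable {V : Type}

/-- Every rational consequence relation satisfies Disjunctive Rationality. -/
theorem stmt9 (V : Type) (K : CRel V) (h : IsRational K) :
    DisjunctiveRationality K := by
  obtain ⟨⟨hrefl, hlle, hrw, hand, -, hcm⟩, hrm⟩ := h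
  intro a b c ha hb hab
  have hA : ((a.disj b).conj a, c) ∉ K := fun h' => ha <| hlle _ _ _ (fun w => by
    simp only [Fm.eval]; cases a.eval w <;> cases b.eval w <;> rfl) h'
  have hB : ((a.disj b).conj b, c) ∉ K := fun h' => hb <| hlle _ _ _ (fun w => by
    simp only [Fm.eval]; cases a.eval w <;> cases b.eval w <;> rfl) h'
  have hnb : (a.disj b, b.neg) ∈ K := by_contra fun h' => hrm _ _ _ hB h' hab
  have haK : (a.disj b, a) ∈ K :=
    hrw _ _ _ (fun w => by
      simp only [Fm.eval]; cases a.eval w <;> cases b.eval w <;> rfl)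
      (hand _ _ _ (hrefl _) hnb)
  exact hA (hcm _ _ _ haK hab)
end

section
/- (Makinson) There exists a preferential consequence relation that satisfies Disjunctive Rationality but is not rational, namely the relation defined by the preferential model over the three propositional variables p_0, p_1, p_2 with three states s_0, s_1, s_2, where l(s_i) satisfies exactly p_i and the only ordered pair is s_1 ≺ s_2. In particular, this relation fails Rational Monotonicity, and every preferential model whose defined relation fails Disjunctive Rationality must have at least 4 states. -/
variable {V : Type}

/-- If `s` is a minimal `a`-state that is not minimal for `a ∨ b`, then some minimal state of
`a ∨ b` lies below `s`, and it satisfies `b` but not `a`. -/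
theorem PrefModel.exists_minIn_disj_lt (W : PrefModel V) {a b : Fm V} {s : W.S}
    (hs : MinIn W.lt {t | a.eval (W.l t) = true} s)
    (hn : ¬ MinIn W.lt {t | (a.disj b).eval (W.l t) = true} s) :
    ∃ u, MinIn W.lt {t | (a.disj b).eval (W.l t) = true} u ∧ W.lt u s ∧
      b.eval (W.l u) = true ∧ ¬ a.eval (W.l u) = true := by
  have h1 : a.eval (W.l s) = true := hs.1
  obtain h | ⟨u, hu, hlt⟩ := W.smooth (a.disj b) s (by simp [Fm.eval, h1])
  · exact absurd h hn
  · have hua : ¬ a.eval (W.l u) = true := fun h => hs.2 u h hlt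
    have hor : a.eval (W.l u) = true ∨ b.eval (W.l u) = true := by
      simpa [Fm.eval] using hu.1
    exact ⟨u, hu, hlt, hor.resolve_left hua, hua⟩

theorem MinIn.disj_comm {W : PrefModel V} {a b : Fm V} {s : W.S}
    (h : MinIn W.lt {t | (a.disj b).eval (W.l t) = true} s) :
    MinIn W.lt {t | (b.disj a).eval (W.l t) = true} s := by
  simpa only [Fm.eval, Bool.or_comm] using h

/-- A preferential model whose relation fails Disjunctive Rationality has four distinct states. -/
theorem PrefModel.exists_four_states (W : PrefModel V) (hW : ¬ DisjunctiveRationality W.Rel) :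
    ∃ a b c d : W.S, a ≠ b ∧ a ≠ c ∧ a ≠ d ∧ b ≠ c ∧ b ≠ d ∧ c ≠ d := by
  simp only [DisjunctiveRationality, not_forall, not_not] at hW
  obtain ⟨a, b, c, ha, hb, hab⟩ := hW
  change ¬ W.Sat a c at ha
  change ¬ W.Sat b c at hb
  change W.Sat (a.disj b) c at hab
  simp only [PrefModel.Sat, not_forall] at ha hb
  obtain ⟨s, hs, hsc⟩ := ha
  obtain ⟨t, ht, htc⟩ := hb
  obtain ⟨u, hu, hus, hub, hua⟩ :=
    W.exists_minIn_disj_lt (b := b) hs fun h => hsc (hab s h)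
  obtain ⟨v, hv, hvt, hva, hvb⟩ :=
    W.exists_minIn_disj_lt (b := a) ht fun h => htc (hab t h.disj_comm)
  have huc := hab u hu
  have hvc := hab v hv.disj_comm
  refine ⟨s, t, u, v, ?_, ?_, ?_, ?_, ?_, ?_⟩
  · rintro rfl
    exact ht.2 u hub hus
  · rintro rfl
    exact hsc huc
  · rintro rfl
    exact hsc hvc
  · rintro rfl
    exact htc huc
  · rintro rfl
    exact htc hvc
  · rintro rfl
    exact hua hva

/-- Makinson's model: the state `i` satisfies exactly the variable `i`, and `1 ≺ 2` is the only
ordered pair. -/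
def makinsonModel : PrefModel (Fin 3) where
  S := Fin 3
  l s i := decide (s = i)
  lt s t := s = 1 ∧ t = 2
  irrefl := by decide
  trans := by decide
  smooth a s hs := by
    by_cases h : s = 2 ∧ a.eval (fun i => decide ((1 : Fin 3) = i)) = true
    · exact Or.inr ⟨1, ⟨h.2, fun t _ ht => absurd ht.2 (by decide)⟩, rfl, h.1⟩
    · refine Or.inl ⟨hs, ?_⟩
      rintro t ht ⟨rfl, rfl⟩
      exact h ⟨rfl, ht⟩

theorem disjunctiveRationality_makinsonModel : DisjunctiveRationality makinsonModel.Rel := by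
  by_contra h
  obtain ⟨a, b, c, d, hne⟩ := makinsonModel.exists_four_states h
  have pigeonhole : ∀ a b c d : Fin 3,
      ¬ (a ≠ b ∧ a ≠ c ∧ a ≠ d ∧ b ≠ c ∧ b ≠ d ∧ c ≠ d) := by decide
  exact pigeonhole a b c d hne

theorem not_rationalMonotonicity_makinsonModel :
    ¬ RationalMonotonicity makinsonModel.Rel := by
  intro h
  refine h .tru (.neg (.var 1)) (.neg (.var 2)) (fun h => ?_) (fun h => ?_) ?_
  · have := h (2 : Fin 3) ⟨rfl, ?_⟩
    · revert this
      decide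
    · rintro t ht ⟨rfl, -⟩
      exact absurd ht (by decide : ¬ (false = true))
  · have := h (0 : Fin 3) ⟨rfl, fun t _ ht => absurd ht.2 (by decide)⟩
    revert this
    decide
  · intro s hs
    change Fin 3 at s
    have h2 : s ≠ 2 := fun h => hs.2 (1 : Fin 3) rfl ⟨rfl, h⟩
    simpa [Fm.eval, makinsonModel] using h2

/-- (Makinson) The concrete three-state model over p₀,p₁,p₂ defines a
preferential relation satisfying Disjunctive Rationality but failing Rational
Monotonicity; moreover any preferential model whose relation fails Disjunctive
Rationality has at least 4 states. -/
theorem stmt10 :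
    (∃ W : PrefModel (Fin 3),
      (∃ e : W.S ≃ Fin 3,
        (∀ s i, W.l s i = true ↔ e s = i) ∧
        (∀ s t, W.lt s t ↔ e s = 1 ∧ e t = 2)) ∧
      IsPreferential W.Rel ∧ DisjunctiveRationality W.Rel ∧
      ¬ RationalMonotonicity W.Rel) ∧
    (∀ (V : Type) (W : PrefModel V), ¬ DisjunctiveRationality W.Rel →
      ∃ a b c d : W.S, a ≠ b ∧ a ≠ c ∧ a ≠ d ∧ b ≠ c ∧ b ≠ d ∧ c ≠ d) := by
  refine ⟨⟨makinsonModel, ⟨Equiv.refl _, fun s i => ?_, fun s t => Iff.rfl⟩,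
    makinsonModel.isPreferential_rel, disjunctiveRationality_makinsonModel,
    not_rationalMonotonicity_makinsonModel⟩, fun V W => W.exists_four_states⟩
  exact decide_eq_true_iff (p := (show Fin 3 from s) = i)
end

section
/- Ranked entailment collapses to preferential entailment: if a conditional assertion A is satisfied by every ranked model satisfying all assertions of a knowledge base K, then A is satisfied by every preferential model satisfying all assertions of K (i.e., A is preferentially entailed by K). -/
variable {V : Type}

open Filter

open Classical in
/-- The label of a family of states along an ultrafilter: the variables true at almost all of them. -/
noncomputable def limitLabel {I S : Type} (U : Ultrafilter I) (l : S → V → Bool) (f : I → S) :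
    V → Bool :=
  fun v => decide (∀ᶠ i in U, l (f i) v = true)

/-- Łoś's theorem for propositional formulas. -/
theorem eval_limitLabel {I S : Type} (U : Ultrafilter I) (l : S → V → Bool) (f : I → S)
    (a : Fm V) :
    a.eval (limitLabel U l f) = true ↔ ∀ᶠ i in U, a.eval (l (f i)) = true := by
  induction a with
  | var v => simp [Fm.eval, limitLabel]
  | fls => simp [Fm.eval, U.neBot.ne]
  | tru => simp [Fm.eval]
  | neg a ha =>
    simp only [Fm.eval, Bool.not_eq_true', ← Bool.not_eq_true, ha, Ultrafilter.eventually_not]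
  | conj a b ha hb => simp only [Fm.eval, Bool.and_eq_true, ha, hb, eventually_and]
  | disj a b ha hb => simp only [Fm.eval, Bool.or_eq_true, ha, hb, Ultrafilter.eventually_or]
  | impl a b ha hb =>
    simp only [Fm.eval, Bool.or_eq_true, Bool.not_eq_true', ← Bool.not_eq_true, ha, hb,
      Ultrafilter.eventually_or, Ultrafilter.eventually_not]
  | iff a b ha hb =>
    have key (x y : Bool) : (x == y) = true ↔ (x = true → y = true) ∧ (y = true → x = true) := by
      cases x <;> cases y <;> simp
    simp only [Fm.eval, key, ha, hb, Ultrafilter.eventually_imp, eventually_and]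

/-- The ranked model whose states are families of states, labeled and ranked along an
ultrafilter. -/
noncomputable def ultraModel {I S : Type} (U : Ultrafilter I) (l : S → V → Bool)
    (r : I → S → ℕ) : PrefModel V where
  S := I → S
  l := limitLabel U l
  lt f g := ∀ᶠ i in U, r i (f i) < r i (g i)
  irrefl f h := by simp [U.neBot.ne] at h
  trans f g k h₁ h₂ := by
    filter_upwards [h₁, h₂] with i hi₁ hi₂ using hi₁.trans hi₂
  smooth a f hf := by
    have hmin (i : I) : ∃ t, a.eval (l (f i)) = true →
        a.eval (l t) = true ∧ ∀ u, a.eval (l u) = true → r i t ≤ r i u := by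
      by_cases hi : a.eval (l (f i)) = true
      · obtain ⟨t, ht, hle⟩ := exists_minimalFor_of_wellFoundedLT
          (fun t => a.eval (l t) = true) (r i) ⟨f i, hi⟩
        exact ⟨t, fun _ => ⟨ht, fun u hu => (le_total _ _).elim id (hle hu)⟩⟩
      · exact ⟨f i, fun h => absurd h hi⟩
    choose g hg using hmin
    have hf' := (eval_limitLabel U l f a).1 hf
    have hle : ∀ k : I → S, a.eval (limitLabel U l k) = true →
        ∀ᶠ i in U, r i (g i) ≤ r i (k i) := fun k hk => by
      filter_upwards [hf', (eval_limitLabel U l k a).1 hk] with i hi hki using (hg i hi).2 _ hki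
    by_cases hlt : ∀ᶠ i in U, r i (g i) < r i (f i)
    · refine .inr ⟨g, ⟨(eval_limitLabel U l g a).2 ?_, fun k hk hkg => ?_⟩, hlt⟩
      · filter_upwards [hf'] with i hi using (hg i hi).1
      · obtain ⟨i, h₁, h₂⟩ := ((hle k hk).and hkg).exists
        exact h₁.not_gt h₂
    · refine .inl ⟨hf, fun k hk hkf => hlt ?_⟩
      filter_upwards [hle k hk, hkf] with i h₁ h₂ using h₁.trans_lt h₂

theorem ultraModel_ranked {I S : Type} (U : Ultrafilter I) (l : S → V → Bool)
    (r : I → S → ℕ) : (ultraModel U l r).Ranked :=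
  ⟨Germ (U : Filter I) ℕ, inferInstance, fun f => Germ.ofFun fun i => r i (f i),
    fun _ _ => Germ.coe_lt.symm⟩

open Classical in
/-- The number of assertions in `F` whose antecedent holds strictly below the state `t`. -/
noncomputable def antecedentRank (W : PrefModel V) (F : Finset (Fm V × Fm V)) (t : W.S) : ℕ :=
  (F.filter fun p => ∃ u, W.lt u t ∧ p.1.eval (W.l u) = true).card

/-- Going down to a minimal state of an antecedent strictly decreases the rank. -/
theorem antecedentRank_lt (W : PrefModel V) {F : Finset (Fm V × Fm V)} {p : Fm V × Fm V}
    (hp : p ∈ F) {t u : W.S} (hu : MinIn W.lt {x | p.1.eval (W.l x) = true} u)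
    (hut : W.lt u t) : antecedentRank W F u < antecedentRank W F t := by
  classical
  refine Finset.card_lt_card (Finset.ssubset_iff_of_subset ?_ |>.2 ⟨p, ?_, ?_⟩)
  · refine Finset.monotone_filter_right _ fun q _ ⟨x, hx, hq⟩ => ⟨x, W.trans _ _ _ hx hut, hq⟩
  · exact Finset.mem_filter.2 ⟨hp, u, hut, hu.1⟩
  · intro h
    obtain ⟨-, x, hx, hxp⟩ := Finset.mem_filter.1 h
    exact hu.2 x hxp hx

/-- Ranked entailment collapses to preferential entailment. -/
theorem stmt13 (V : Type) (K : CRel V) (A : Fm V × Fm V)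
    (h : ∀ W : PrefModel V, W.Ranked → W.Models K → W.Sat A.1 A.2) :
    Entails K A := by
  classical
  intro W hW s hs
  let T := {t : W.S // t = s ∨ W.lt t s}
  let U : Ultrafilter (Finset (Fm V × Fm V)) := Ultrafilter.of atTop
  let l : T → V → Bool := fun t => W.l t
  let r : Finset (Fm V × Fm V) → T → ℕ := fun F t => antecedentRank W F t
  have hmodels : (ultraModel U l r).Models K := by
    rintro p hp f ⟨hf, hmin⟩
    by_contra hfp
    have hf₁ : ∀ᶠ F in U, p.1.eval (l (f F)) = true := (eval_limitLabel U l f _).1 hf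
    have hf₂ : ∀ᶠ F in U, ¬ p.2.eval (l (f F)) = true :=
      Ultrafilter.eventually_not.2 fun hc => hfp ((eval_limitLabel U l f _).2 hc)
    have hmem : ∀ᶠ F in (U : Filter (Finset (Fm V × Fm V))), p ∈ F := by
      refine Ultrafilter.of_le atTop ?_
      filter_upwards [eventually_ge_atTop {p}] with F hF using hF (Finset.mem_singleton_self p)
    have hstep : ∀ᶠ F in U, ∃ t : T, p.1.eval (l t) = true ∧ r F t < r F (f F) := by
      filter_upwards [hf₁, hf₂, hmem] with F h₁ h₂ hF
      obtain hm | ⟨u, hu, hlt⟩ := W.smooth p.1 (f F) h₁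
      · exact absurd (hW p hp _ hm) h₂
      · refine ⟨⟨u, .inr ?_⟩, hu.1, antecedentRank_lt W hF hu hlt⟩
        obtain hfs | hfs := (f F).2
        · exact hfs ▸ hlt
        · exact W.trans _ _ _ hlt hfs
    obtain ⟨g, hg⟩ := hstep.choice
    exact hmin g ((eval_limitLabel U l g _).2 (hg.mono fun _ => And.left))
      (hg.mono fun _ => And.right)
  let c : Finset (Fm V × Fm V) → T := fun _ => ⟨s, .inl rfl⟩
  have hc : A.2.eval (limitLabel U l c) = true := by
    refine h _ (ultraModel_ranked U l r) hmodels c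
      ⟨(eval_limitLabel U l c _).2 (.of_forall fun _ => hs.1), fun g hg hlt => ?_⟩
    obtain ⟨F, hgF, hltF⟩ := (((eval_limitLabel U l g _).1 hg).and hlt).exists
    obtain hgs | hgs := (g F).2
    · have : g F = c F := Subtype.ext hgs
      simp [this] at hltF
    · exact hs.2 _ hgF hgs
  obtain ⟨_, hF⟩ := ((eval_limitLabel U l c _).1 hc).exists
  exact hF
end

section
/- There exists a finite conditional knowledge base that has no perfect rational extension. Concretely, over the propositional language on four variables a, b, c, d, let W be the preferential model with three states s, t, u in which s ≺ t is the only ordered pair, s satisfies only a, t satisfies only b, and u satisfies only c and d; then the set K of all conditional assertions satisfied by W has no perfect rational extension. -/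
variable {V : Type}

/-- The three-state model: states `0`, `1`, `2` are `s`, `t`, `u`, with `s ≺ t` only. -/
def threeStateModel : PrefModel (Fin 4) where
  S := Fin 3
  l st v := decide ((st = 0 ∧ v = 0) ∨ (st = 1 ∧ v = 1) ∨ (st = 2 ∧ (v = 2 ∨ v = 3)))
  lt s t := s = 0 ∧ t = 1
  irrefl := by decide
  trans := by decide
  smooth a s hs := by
    by_cases h : s = 1 ∧ a.eval
        (fun v : Fin 4 => decide (((0 : Fin 3) = 0 ∧ v = 0) ∨ ((0 : Fin 3) = 1 ∧ v = 1) ∨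
          ((0 : Fin 3) = 2 ∧ (v = 2 ∨ v = 3)))) = true
    · exact Or.inr ⟨0, ⟨h.2, fun t _ ht => absurd ht.2 (by decide)⟩, rfl, h.1⟩
    · refine Or.inl ⟨hs, ?_⟩
      rintro t ht ⟨rfl, rfl⟩
      exact h ⟨rfl, ht⟩

/-- An assertion supported by the relation of a model is witnessed in that model. -/
theorem Supported.exists_sat {W : PrefModel V} {a b : Fm V} (h : Supported W.Rel (a, b)) :
    ∃ c : Fm V, Valid (a.impl c) ∧ W.Sat c b :=
  let ⟨c, hc, hb⟩ := h
  ⟨c, hc, hb W fun _ hp => hp⟩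

theorem Valid.eval_of_impl {a c : Fm V} (h : Valid (a.impl c)) {w : V → Bool}
    (ha : a.eval w = true) : c.eval w = true := by
  simpa [Fm.eval, ha] using h w

/-- The set of all assertions satisfied by the concrete three-state model over
the variables a=0, b=1, c=2, d=3 has no perfect rational extension. -/
theorem stmt14 :
    ∃ W : PrefModel (Fin 4),
      (∃ e : W.S ≃ Fin 3,
        (∀ st v, W.l st v = true ↔
          ((e st = 0 ∧ v = 0) ∨ (e st = 1 ∧ v = 1) ∨
            (e st = 2 ∧ (v = 2 ∨ v = 3)))) ∧
        (∀ s t, W.lt s t ↔ e s = 0 ∧ e t = 1)) ∧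
      ¬ ∃ R : CRel (Fin 4), IsRational R ∧ W.Rel ⊆ R ∧
          ∀ A ∈ R, Supported W.Rel A := by
  refine ⟨threeStateModel, ⟨Equiv.refl _, fun _ _ => by
    simp only [threeStateModel, decide_eq_true_eq]; rfl, fun _ _ => Iff.rfl⟩, ?_⟩
  rintro ⟨R, ⟨⟨hrefl, -, hrw, hand, -, -⟩, hrm⟩, hsub, hsupp⟩
  have htop : (Fm.tru, (Fm.var 1).neg) ∈ R := by
    refine hsub fun s hs => ?_
    have h1 : s ≠ (1 : Fin 3) := fun h => hs.2 (0 : Fin 3) rfl ⟨rfl, h⟩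
    revert h1
    exact (by decide : ∀ s : Fin 3, s ≠ 1 →
      ((Fm.var 1).neg : Fm (Fin 4)).eval (threeStateModel.l s) = true) s
  have hc : (Fm.tru, (Fm.var 2).neg) ∉ R := fun h => by
    obtain ⟨c, hv, hsat⟩ := (hsupp _ h).exists_sat
    exact absurd (hsat (2 : Fin 3)
      ⟨hv.eval_of_impl rfl, fun _ _ ht => absurd ht.2 (by decide)⟩) (by decide)
  have hbc : (Fm.tru, ((Fm.var 1).disj (Fm.var 2)).neg) ∉ R := fun h =>
    hc (hrw _ _ _ (fun w => by cases h1 : w 1 <;> cases h2 : w 2 <;> simp [Fm.eval, h1, h2]) h)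
  have hX : (Fm.tru.conj ((Fm.var 1).disj (Fm.var 2)), (Fm.var 1).neg) ∈ R := by
    by_contra h
    exact hrm _ _ _ h hbc htop
  obtain ⟨c, hv, hsat⟩ := (hsupp _ (hand _ _ _ (hrefl _) hX)).exists_sat
  by_cases h0 : c.eval (threeStateModel.l (0 : Fin 3)) = true
  · exact absurd (hsat (0 : Fin 3) ⟨h0, fun _ _ ht => absurd ht.2 (by decide)⟩) (by decide)
  · refine absurd (hsat (1 : Fin 3) ⟨hv.eval_of_impl (by decide), ?_⟩) (by decide)
    rintro t ht ⟨rfl, -⟩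
    exact h0 ht
end
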